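/- arXiv:2110.03310 — 2 statements merged into one kernel-verified Lean document; each statement's English description precedes it below -/
import Mathlib

section
/- (Kolmogorov superposition theorem) For every n ≥ 1 there exist n constants λ_1, …, λ_n with λ_j > 0 and Σ_{j=1}^n λ_j ≤ 1, and 2n+1 strictly increasing continuous functions φ_1, …, φ_{2n+1} mapping [0,1] into [0,1], such that for every continuous function u : [0,1]^n → ℝ there exists a continuous function h : [0,1] → ℝ with u(x_1, …, x_n) = Σ_{i=1}^{2n+1} h( Σ_{j=1}^n λ_j φ_i(x_j) ) for all (x_1, …, x_n) ∈ [0,1]^n. -/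
open Set Topology

/-- A bounded operator from a Banach space that admits approximate preimages, with relative error
bounded away from one, is surjective. -/
theorem ContinuousLinearMap.surjective_of_approx_preimage {E F : Type*} [NormedAddCommGroup E]
    [NormedSpace ℝ E] [CompleteSpace E] [NormedAddCommGroup F] [NormedSpace ℝ F]
    (T : E →L[ℝ] F) {C θ : ℝ} (hθ₀ : 0 ≤ θ) (hθ : θ < 1) (hC : 0 ≤ C)
    (h : ∀ f, ∃ e, ‖e‖ ≤ C * ‖f‖ ∧ ‖f - T e‖ ≤ θ * ‖f‖) : Function.Surjective T := by
  intro f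
  choose s hs₁ hs₂ using h
  let r : ℕ → F := fun m => (fun g => g - T (s g))^[m] f
  have hr_succ : ∀ m, r (m + 1) = r m - T (s (r m)) := fun m =>
    Function.iterate_succ_apply' _ _ _
  have hr : ∀ m, ‖r m‖ ≤ ‖f‖ * θ ^ m := by
    intro m
    induction m with
    | zero => simp [r]
    | succ m ih =>
      rw [hr_succ]
      calc _ ≤ θ * ‖r m‖ := hs₂ _
        _ ≤ θ * (‖f‖ * θ ^ m) := by gcongr
        _ = _ := by ring
  have hgeom := summable_geometric_of_lt_one hθ₀ hθ
  have hsum : Summable fun m => s (r m) := by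
    refine Summable.of_norm_bounded ((hgeom.mul_left (C * ‖f‖))) fun m => ?_
    calc _ ≤ C * ‖r m‖ := hs₁ _
      _ ≤ C * (‖f‖ * θ ^ m) := by gcongr; exact hr m
      _ = _ := by ring
  refine ⟨∑' m, s (r m), ?_⟩
  have h₁ := (T.hasSum hsum.hasSum).tendsto_sum_nat
  have h₂ : ∀ m, ∑ k ∈ Finset.range m, T (s (r k)) = f - r m := by
    intro m
    induction m with
    | zero => simp [r]
    | succ m ih => rw [Finset.sum_range_succ, ih, hr_succ]; abel
  have h₃ : Filter.Tendsto r Filter.atTop (𝓝 0) := by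
    refine squeeze_zero_norm hr ?_
    simpa using (tendsto_pow_atTop_nhds_zero_of_lt_one hθ₀ hθ).const_mul ‖f‖
  have h₄ : Filter.Tendsto (fun m => f - r m) Filter.atTop (𝓝 (f - 0)) := h₃.const_sub f
  simp only [h₂] at h₁
  simpa using tendsto_nhds_unique h₁ h₄

/-- There are positive weights of total mass one that are independent over the integers. -/
theorem exists_pos_weights_injective (n : ℕ) (hn : 1 ≤ n) :
    ∃ lam : Fin n → ℝ, (∀ j, 0 < lam j) ∧ ∑ j, lam j ≤ 1 ∧
      ∀ a b : Fin n → ℕ, ∑ j, lam j * a j = ∑ j, lam j * b j → a = b := by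
  obtain ⟨t, ht, htr⟩ : ∃ t : ℝ, 0 < t ∧ Transcendental ℤ t :=
    ⟨liouvilleNumber (2 : ℕ), by
      have h₂ : (1 : ℝ) < (2 : ℕ) := by norm_num
      rw [← LiouvilleNumber.partialSum_add_remainder h₂ 0]
      exact add_pos_of_nonneg_of_pos (Finset.sum_nonneg fun _ _ => by positivity)
        (LiouvilleNumber.remainder_pos h₂ 0), transcendental_liouvilleNumber le_rfl⟩
  have : Nonempty (Fin n) := ⟨⟨0, hn⟩⟩
  have hS : 0 < ∑ l : Fin n, t ^ (l : ℕ) :=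
    Finset.sum_pos (fun l _ => by positivity) Finset.univ_nonempty
  refine ⟨fun j => t ^ (j : ℕ) / ∑ l : Fin n, t ^ (l : ℕ), fun j => by positivity, ?_, ?_⟩
  · rw [← Finset.sum_div, div_self hS.ne']
  · intro a b hab
    have h₁ : ∑ j : Fin n, t ^ (j : ℕ) * (a j : ℝ) = ∑ j : Fin n, t ^ (j : ℕ) * (b j : ℝ) := by
      simp only [div_mul_eq_mul_div, ← Finset.sum_div] at hab
      exact (div_left_inj' hS.ne').1 hab
    let p : Polynomial ℤ := ∑ j : Fin n, Polynomial.monomial (j : ℕ) ((a j : ℤ) - b j)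
    have hp : p = 0 := by
      by_contra h0
      refine htr ⟨p, h0, ?_⟩
      simp only [p, map_sum, Polynomial.aeval_monomial]
      simp only [algebraMap_int_eq, eq_intCast, Int.cast_sub, Int.cast_natCast, sub_mul,
        Finset.sum_sub_distrib]
      simp only [mul_comm _ (t ^ _)]
      linarith
    funext j
    have := congrArg (Polynomial.coeff · (j : ℕ)) hp
    simp only [p, Polynomial.finsetSum_coeff, Polynomial.coeff_monomial, Fin.val_inj,
      Finset.sum_ite_eq', Finset.mem_univ, if_true, Polynomial.coeff_zero] at this
    omega

/-- A staircase through the values `v k`, constant between consecutive ramps of length one. -/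
theorem exists_staircase (D i N : ℕ) {v : ℕ → ℝ} (hv : Monotone v) :
    ∃ g : ℝ → ℝ, Continuous g ∧ Monotone g ∧
      ∀ k ≤ N, ∀ t : ℝ, D * k + i + 1 ≤ t + D → t ≤ D * k + i → g t = v k := by
  refine ⟨fun t => v 0 + ∑ k ∈ Finset.range N,
    (v (k + 1) - v k) * max 0 (min 1 (t - (D * k + i))), by fun_prop, ?_, ?_⟩
  · intro s t hst
    dsimp only
    gcongr with k hk
    exact sub_nonneg.2 (hv k.le_succ)
  · intro k hk t h₁ h₂
    obtain ⟨l, rfl⟩ := Nat.exists_eq_add_of_le hk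
    have e₁ : ∀ m ∈ Finset.range k, (v (m + 1) - v m) * max 0 (min 1 (t - (D * m + i)))
        = v (m + 1) - v m := by
      intro m hm
      have : (D : ℝ) * (m + 1) ≤ D * k := by
        gcongr; exact_mod_cast Finset.mem_range.1 hm
      rw [min_eq_left (by linarith), max_eq_right zero_le_one, mul_one]
    have e₂ : ∀ m ∈ Finset.range l,
        (v (k + m + 1) - v (k + m)) * max 0 (min 1 (t - (D * (k + m : ℕ) + i))) = 0 := by
      intro m hm
      have : (D : ℝ) * k ≤ D * (k + m : ℕ) := by gcongr; omega
      rw [max_eq_left ((min_le_right _ _).trans (by linarith)), mul_zero]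
    dsimp only
    rw [Finset.sum_range_add, Finset.sum_congr rfl e₁, Finset.sum_congr rfl e₂,
      Finset.sum_range_sub]
    simp

/-- Every point of `[0, D * N]` avoids all but one of the `D` families of unit gaps. -/
theorem exists_forall_ne_mem_plateau {D N : ℕ} (hD : 0 < D) {t : ℝ} (ht₀ : 0 ≤ t)
    (ht : t ≤ D * N) :
    ∃ r : Fin D, ∀ i : Fin D, i ≠ r →
      ∃ k ≤ N, (D * k + i + 1 : ℝ) ≤ t + D ∧ t ≤ D * k + i := by
  set m := ⌊t⌋₊
  have hm₁ : (m : ℝ) ≤ t := Nat.floor_le ht₀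
  have hm₂ : t < m + 1 := Nat.lt_floor_add_one t
  have hmN : m ≤ D * N := by exact_mod_cast hm₁.trans ht
  have hmod := Nat.div_add_mod m D
  have hlt := Nat.mod_lt m hD
  set q := m / D
  set r := m % D
  have hqN : q ≤ N := by
    by_contra! hh
    nlinarith
  have hmod' : (D * q + r : ℝ) = m := by exact_mod_cast hmod
  refine ⟨⟨r, hlt⟩, fun i hir => ?_⟩
  have hir' : (i : ℕ) ≠ r := fun hh => hir (Fin.ext hh)
  have hiD := i.2
  rcases lt_or_gt_of_ne hir' with hh | hh
  · refine ⟨q + 1, ?_, ?_, ?_⟩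
    · by_contra! hc
      have : q = N := by omega
      subst this
      omega
    · have : ((i : ℕ) : ℝ) + 1 ≤ r := by exact_mod_cast hh
      push_cast
      linarith
    · have : (r : ℝ) + 1 ≤ D := by exact_mod_cast hlt
      have : (0 : ℝ) ≤ (i : ℕ) := by positivity
      push_cast
      linarith
  · refine ⟨q, hqN, ?_, ?_⟩
    · have : ((i : ℕ) : ℝ) + 1 ≤ D := by exact_mod_cast hiD
      have : (0 : ℝ) ≤ r := by positivity
      linarith
    · have : (r : ℝ) + 1 ≤ (i : ℕ) := by exact_mod_cast hh
      linarith

open unitInterval BoundedContinuousFunction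

/-- The continuous monotone maps of the unit interval into itself. -/
def monotoneSelfMaps : Set C(I, ℝ) := {g | Monotone g ∧ ∀ x, g x ∈ Icc (0 : ℝ) 1}

theorem isClosed_monotoneSelfMaps : IsClosed monotoneSelfMaps := by
  have h₁ : IsClosed {g : C(I, ℝ) | Monotone g} :=
    isClosed_monotone.preimage (continuous_pi fun x => continuous_eval_const x)
  have h₂ : IsClosed {g : C(I, ℝ) | ∀ x, g x ∈ Icc (0 : ℝ) 1} := by
    simp only [ofPred_forall]
    exact isClosed_iInter fun x => isClosed_Icc.preimage (continuous_eval_const x)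
  exact h₁.inter h₂

/-- The grid point `k / N`, clipped to the unit interval. -/
noncomputable def gridPoint (N k : ℕ) : I := projIcc 0 1 zero_le_one (k / N : ℝ)

theorem coe_gridPoint {N k : ℕ} (hN : 0 < N) (hk : k ≤ N) : (gridPoint N k : ℝ) = k / N := by
  have h : (k / N : ℝ) ∈ Icc (0 : ℝ) 1 :=
    ⟨by positivity, div_le_one_of_le₀ (by exact_mod_cast hk) (by positivity)⟩
  rw [gridPoint, projIcc_of_mem _ h]

theorem monotone_gridPoint (N : ℕ) : Monotone (gridPoint N) := fun a b hab =>
  monotone_projIcc _ (by gcongr)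

/-- A monotone self map is approximated by one taking prescribed values on plateaus. -/
theorem exists_plateau_map {D i N : ℕ} (hi : i < D) (hN : 0 < N) {g : C(I, ℝ)}
    {w : ℕ → ℝ} (hw : Monotone w) (hw₀ : 0 ≤ w 0) (hw₁ : w N ≤ 1)
    {δ : ℝ} (hδ : ∀ x y : I, dist x y ≤ 1 / N → |g x - g y| ≤ δ)
    (hwg : ∀ k ≤ N, |w k - g (gridPoint N k)| ≤ δ) :
    ∃ ψ ∈ monotoneSelfMaps, (∀ x, |ψ x - g x| ≤ 2 * δ) ∧
      ∀ k ≤ N, ∀ x : I, (D * k + i + 1 : ℝ) ≤ D * N * x + D → (D * N * x : ℝ) ≤ D * k + i →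
        ψ x = w k := by
  obtain ⟨s, hs, hsm, hsv⟩ := exists_staircase D i N hw
  have hiD : (i : ℝ) + 1 ≤ D := by exact_mod_cast hi
  have hN' : (0 : ℝ) < N := by exact_mod_cast hN
  have hm : Monotone fun x : I => s (D * N * x) := fun x y hxy =>
    hsm (mul_le_mul_of_nonneg_left hxy (by positivity))
  have hgrid : ∀ k ≤ N, s (D * N * (gridPoint N k : I)) = w k := by
    intro k hk
    have : (D * N * (gridPoint N k : I) : ℝ) = D * k := by
      rw [coe_gridPoint hN hk]; field_simp
    rw [this]
    exact hsv k hk _ (by linarith) (by linarith [(Nat.cast_nonneg i : (0 : ℝ) ≤ i)])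
  have hg₀ : gridPoint N 0 = 0 := Subtype.ext (by simp [coe_gridPoint hN])
  have hg₁ : gridPoint N N = 1 := Subtype.ext (by rw [coe_gridPoint hN le_rfl]; field_simp; simp)
  refine ⟨⟨fun x : I => s (D * N * x), by fun_prop⟩, ⟨hm, fun x => ⟨?_, ?_⟩⟩, fun x => ?_,
    fun k hk x h₁ h₂ => hsv k hk _ h₁ h₂⟩
  · exact (hw₀.trans_eq (by rw [← hgrid 0 N.zero_le, hg₀])).trans (hm x.2.1)
  · exact (hm (show x ≤ 1 from x.2.2)).trans (by rw [← hg₁]; exact (hgrid N le_rfl).trans_le hw₁)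
  · obtain ⟨k, hk, hx₁, hx₂⟩ : ∃ k < N, (k / N : ℝ) ≤ x ∧ (x : ℝ) ≤ (k + 1 : ℕ) / N := by
      rcases x.2.2.eq_or_lt with h | h
      · refine ⟨N - 1, by omega, ?_, ?_⟩
        · rw [h]
          exact div_le_one_of_le₀ (by exact_mod_cast Nat.sub_le _ _) hN'.le
        · rw [h, Nat.sub_add_cancel hN, div_self hN'.ne']
      · have h₀ : 0 ≤ (x : ℝ) * N := mul_nonneg x.2.1 hN'.le
        refine ⟨⌊(x : ℝ) * N⌋₊, ?_, ?_, ?_⟩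
        · rw [Nat.floor_lt h₀]; nlinarith
        · rw [div_le_iff₀ hN']; exact Nat.floor_le h₀
        · rw [le_div_iff₀ hN']; push_cast; exact (Nat.lt_floor_add_one _).le
    have hk' : k + 1 ≤ N := hk
    have c₁ := coe_gridPoint hN hk.le
    have c₂ := coe_gridPoint hN hk'
    have hstep : ((k + 1 : ℕ) / N : ℝ) = k / N + 1 / N := by push_cast; ring
    have l₁ : w k ≤ s (D * N * x) := hgrid k hk.le ▸ hm (Subtype.coe_le_coe.1 (c₁ ▸ hx₁))
    have l₂ : s (D * N * x) ≤ w (k + 1) := hgrid _ hk' ▸ hm (Subtype.coe_le_coe.1 (c₂ ▸ hx₂))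
    have d₁ := abs_le.1 (hδ x (gridPoint N k) (by
      rw [Subtype.dist_eq, Real.dist_eq, c₁, abs_le]; constructor <;> linarith))
    have d₂ := abs_le.1 (hδ x (gridPoint N (k + 1)) (by
      rw [Subtype.dist_eq, Real.dist_eq, c₂, abs_le]; constructor <;> linarith))
    have e₁ := abs_le.1 (hwg k hk.le)
    have e₂ := abs_le.1 (hwg _ hk')
    simp only [ContinuousMap.coe_mk]
    rw [abs_le]
    constructor <;> linarith

/-- Finitely many monotone self maps are approximated by ones whose values on the plateaus are
distinct natural multiples of one positive number. -/
theorem exists_plateau_family {D N : ℕ} (hN : 0 < N) {φ : Fin D → C(I, ℝ)}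
    (hφ : ∀ i, φ i ∈ monotoneSelfMaps) {δ : ℝ} (hδ₀ : 0 < δ)
    (hδ : ∀ i, ∀ x y : I, dist x y ≤ 1 / N → |φ i x - φ i y| ≤ δ) :
    ∃ (ψ : Fin D → C(I, ℝ)) (m : Fin D → ℕ → ℕ) (c : ℝ), 0 < c ∧
      (∀ i, ψ i ∈ monotoneSelfMaps) ∧ (∀ i x, |ψ i x - φ i x| ≤ 2 * δ) ∧
      (∀ i : Fin D, ∀ k ≤ N, ∀ i' : Fin D, ∀ k' ≤ N, m i k = m i' k' → i = i' ∧ k = k') ∧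
      ∀ i : Fin D, ∀ k ≤ N, ∀ x : I, (D * k + (i : ℕ) + 1 : ℝ) ≤ D * N * x + D →
        (D * N * x : ℝ) ≤ D * k + (i : ℕ) → ψ i x = c * m i k := by
  rcases Nat.eq_zero_or_pos D with rfl | hD
  · exact ⟨φ, fun _ _ => 0, 1, one_pos, hφ, fun i => i.elim0, fun i => i.elim0, fun i => i.elim0⟩
  obtain ⟨Q, hQ⟩ := exists_nat_gt (2 / δ)
  have hQ₀ : (0 : ℝ) < Q := lt_trans (by positivity) hQ
  have hQδ : 2 / (Q : ℝ) ≤ δ := by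
    rw [div_lt_iff₀ hδ₀] at hQ
    rw [div_le_iff₀ hQ₀]; linarith
  set L := (N + 1) * D with hL
  have hL₀ : 0 < L := by positivity
  have hL₀' : (0 : ℝ) < L := by exact_mod_cast hL₀
  let A : Fin D → ℕ → ℕ := fun i k => ⌊φ i (gridPoint N k) * Q⌋₊
  let m : Fin D → ℕ → ℕ := fun i k => L * A i k + (D * k + i)
  have hidx : ∀ (i : Fin D), ∀ k ≤ N, D * k + i < L := by
    intro i k hk
    have := i.2
    have : D * k ≤ D * N := Nat.mul_le_mul_left D hk
    rw [hL]; linarith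
  have hc₀ : (0 : ℝ) < 1 / ((Q + 1) * L) := by positivity
  have hA : ∀ i, Monotone (A i) := fun i a b hab =>
    Nat.floor_mono (mul_le_mul_of_nonneg_right ((hφ i).1 (monotone_gridPoint N hab)) hQ₀.le)
  have hm : ∀ i, Monotone (m i) := fun i a b hab =>
    Nat.add_le_add (Nat.mul_le_mul_left _ (hA i hab))
      (Nat.add_le_add_right (Nat.mul_le_mul_left _ hab) _)
  have hlow : ∀ i, ∀ k, (A i k : ℝ) / (Q + 1) ≤ 1 / ((Q + 1) * L) * m i k := by
    intro i k
    rw [one_div_mul_eq_div, div_le_div_iff₀ (by positivity) (by positivity)]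
    have : (L * A i k : ℝ) ≤ m i k := by exact_mod_cast Nat.le_add_right _ _
    nlinarith
  have hupp : ∀ i, ∀ k ≤ N, 1 / ((Q + 1) * L) * m i k ≤ ((A i k : ℝ) + 1) / (Q + 1) := by
    intro i k hk
    rw [one_div_mul_eq_div, div_le_div_iff₀ (by positivity) (by positivity)]
    have : (m i k : ℝ) ≤ L * (A i k + 1) := by
      have : m i k ≤ L * (A i k + 1) := by
        have := hidx i k hk
        simp only [m, mul_add, mul_one]; omega
      exact_mod_cast this
    nlinarith
  have hA₁ : ∀ i k, (A i k : ℝ) ≤ φ i (gridPoint N k) * Q := fun i k =>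
    Nat.floor_le (mul_nonneg ((hφ i).2 _).1 hQ₀.le)
  have hA₂ : ∀ i k, φ i (gridPoint N k) * Q < A i k + 1 := fun i k => Nat.lt_floor_add_one _
  have hclose : ∀ i, ∀ k ≤ N, |1 / ((Q + 1) * L) * m i k - φ i (gridPoint N k)| ≤ δ := by
    intro i k hk
    have h₁ := hA₁ i k
    have h₂ := hA₂ i k
    have h₀ := ((hφ i).2 (gridPoint N k)).1
    have h₃ := ((hφ i).2 (gridPoint N k)).2
    have hlow := hlow i k
    have hupp := hupp i k hk
    set y := φ i (gridPoint N k)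
    have u₁ : ((A i k : ℝ) + 1) / (Q + 1) ≤ y + 2 / Q := by
      rw [div_le_iff₀ (by positivity)]
      have : (0 : ℝ) ≤ 2 / Q := by positivity
      have : (2 / Q * Q : ℝ) = 2 := by field_simp
      nlinarith
    have u₂ : y - 2 / Q ≤ (A i k : ℝ) / (Q + 1) := by
      rw [le_div_iff₀ (by positivity)]
      have : (0 : ℝ) ≤ 2 / Q := by positivity
      have : (2 / Q * Q : ℝ) = 2 := by field_simp
      nlinarith
    rw [abs_le]; constructor <;> linarith
  have key := fun i : Fin D => exists_plateau_map (w := fun k => 1 / ((Q + 1) * L) * m i k) i.2 hN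
    (fun a b hab => mul_le_mul_of_nonneg_left (by exact_mod_cast hm i hab) hc₀.le)
    (by positivity)
    ((hupp i N le_rfl).trans <| div_le_one_of_le₀ (by
      have := hA₁ i N
      have := ((hφ i).2 (gridPoint N N)).2
      nlinarith) (by positivity)) (hδ i) (hclose i)
  choose ψ h₁ h₂ h₃ using key
  refine ⟨ψ, m, _, hc₀, h₁, h₂, fun i k hk i' k' hk' h => ?_, h₃⟩
  have e₁ : D * k + i = D * k' + i' := by
    have := congrArg (· % L) h
    simpa [m, Nat.mul_add_mod, Nat.mod_eq_of_lt (hidx _ _ hk), Nat.mod_eq_of_lt (hidx _ _ hk')]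
      using this
  have e₂ : (i : ℕ) = i' := by
    have := congrArg (· % D) e₁
    simpa [Nat.mul_add_mod, Nat.mod_eq_of_lt i.2, Nat.mod_eq_of_lt i'.2] using this
  exact ⟨Fin.ext e₂, Nat.eq_of_mul_eq_mul_left hD (by omega)⟩

/-- The map `x ↦ Σ_j λ_j g(x_j)` on the unit cube. -/
noncomputable def weightedSum {n : ℕ} (lam : Fin n → ℝ) (g : C(I, ℝ)) : C(Fin n → I, ℝ) :=
  ⟨fun x => ∑ j, lam j * g (x j), by fun_prop⟩

/-- The operator sending `h` to the superposition `x ↦ Σ_i h(Σ_j λ_j φ_i(x_j))`. -/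
noncomputable def superposition {n D : ℕ} (lam : Fin n → ℝ) (φ : Fin D → C(I, ℝ)) :
    (ℝ →ᵇ ℝ) →L[ℝ] C(Fin n → I, ℝ) :=
  LinearMap.mkContinuous
    { toFun := fun h => ∑ i, (h : C(ℝ, ℝ)).comp (weightedSum lam (φ i))
      map_add' := fun h k => by
        ext x; simp [Finset.sum_add_distrib]
      map_smul' := fun a h => by
        ext x; simp [Finset.mul_sum] } D fun h => by
    refine (ContinuousMap.norm_le _ (by positivity)).2 fun x => ?_
    simp only [LinearMap.coe_mk, AddHom.coe_mk, ContinuousMap.sum_apply]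
    refine (norm_sum_le_of_le Finset.univ fun i _ => h.norm_coe_le_norm _).trans ?_
    simp

theorem superposition_apply {n D : ℕ} (lam : Fin n → ℝ) (φ : Fin D → C(I, ℝ)) (h : ℝ →ᵇ ℝ)
    (x : Fin n → I) :
    superposition lam φ h x = ∑ i, h (∑ j, lam j * φ i (x j)) := by
  simp [superposition, weightedSum]

theorem continuous_superposition {n D : ℕ} (lam : Fin n → ℝ) (h : ℝ →ᵇ ℝ) :
    Continuous fun φ : Fin D → C(I, ℝ) => superposition lam φ h := by
  refine ContinuousMap.continuous_of_continuous_uncurry _ ?_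
  simp only [Function.uncurry_def, superposition_apply]
  fun_prop

/-- If inner functions take separating values on fine plateaus, then a single outer function
reduces the given function by a fixed factor. -/
theorem exists_superposition_approx {n N : ℕ} (hn : 1 ≤ n) (hN : 0 < N) {lam : Fin n → ℝ}
    (hlam : ∀ a b : Fin n → ℕ, ∑ j, lam j * a j = ∑ j, lam j * b j → a = b)
    {ψ : Fin (2 * n + 1) → C(I, ℝ)} {m : Fin (2 * n + 1) → ℕ → ℕ} {c : ℝ} (hc : 0 < c)
    (hm : ∀ i : Fin (2 * n + 1), ∀ k ≤ N, ∀ i' : Fin (2 * n + 1), ∀ k' ≤ N,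
      m i k = m i' k' → i = i' ∧ k = k')
    (hψ : ∀ i : Fin (2 * n + 1), ∀ k ≤ N, ∀ x : I,
      ((2 * n + 1 : ℕ) * k + (i : ℕ) + 1 : ℝ) ≤ (2 * n + 1 : ℕ) * N * x + (2 * n + 1 : ℕ) →
      ((2 * n + 1 : ℕ) * N * x : ℝ) ≤ (2 * n + 1 : ℕ) * k + (i : ℕ) → ψ i x = c * m i k)
    (f : C(Fin n → I, ℝ))
    (hf : ∀ x y, dist x y ≤ 1 / N → |f x - f y| ≤ ‖f‖ / (2 * (2 * n + 1))) :
    ∃ h : ℝ →ᵇ ℝ, ‖h‖ ≤ ‖f‖ ∧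
      ‖f - superposition lam ψ h‖ ≤ (1 - 1 / (2 * (2 * n + 1))) * ‖f‖ := by
  set M := ‖f‖
  have hM : 0 ≤ M := norm_nonneg f
  have hN' : (0 : ℝ) < N := by exact_mod_cast hN
  let d : ℝ := 2 * n + 1
  have hd : (2 * n + 1 : ℕ) = d := by simp [d]
  have hd₁ : 1 ≤ d := by simp [d]
  have hd₀ : 0 < d := by linarith
  let e : Fin (2 * n + 1) × (Fin n → Fin (N + 1)) → ℝ :=
    fun p => ∑ j, lam j * (c * m p.1 (p.2 j))
  have he : Function.Injective e := by
    rintro ⟨i, k⟩ ⟨i', k'⟩ h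
    have h' : ∑ j, lam j * (m i (k j) : ℕ) = ∑ j, lam j * (m i' (k' j) : ℕ) := by
      simp only [e, mul_left_comm _ c, ← Finset.mul_sum] at h
      exact mul_left_cancel₀ hc.ne' h
    have h'' := fun j => hm i (k j) (Nat.lt_succ_iff.1 (k j).2) i' (k' j)
      (Nat.lt_succ_iff.1 (k' j).2) (congrFun (hlam _ _ h') j)
    exact Prod.ext (h'' ⟨0, hn⟩).1 (funext fun j => Fin.ext (h'' j).2)
  let g : (Fin (2 * n + 1) × (Fin n → Fin (N + 1))) →ᵇ ℝ :=
    BoundedContinuousFunction.mkOfCompact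
      ⟨fun p => f (fun j => gridPoint N (p.2 j)) / d, continuous_of_discreteTopology⟩
  have hg : ‖g‖ ≤ M / d := by
    refine (BoundedContinuousFunction.norm_le (by positivity)).2 fun p => ?_
    change ‖f _ / d‖ ≤ _
    rw [norm_div, Real.norm_of_nonneg hd₀.le]
    gcongr
    exact f.norm_coe_le_norm _
  obtain ⟨h, hh, hhe⟩ := BoundedContinuousFunction.exists_extension_norm_eq_of_isClosedEmbedding g
    ((continuous_of_discreteTopology (f := e)).isClosedEmbedding he)
  have hhM : ‖h‖ ≤ M / d := hh.trans_le hg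
  refine ⟨h, hhM.trans (div_le_self hM hd₁), ?_⟩
  have hθ : (0 : ℝ) ≤ 1 - 1 / (2 * (2 * n + 1)) := by
    rw [sub_nonneg, div_le_one (by positivity)]
    linarith [(Nat.cast_nonneg n : (0 : ℝ) ≤ n)]
  refine (ContinuousMap.norm_le _ (by positivity)).2 fun x => ?_
  have hx : ∀ j, ∃ r : Fin (2 * n + 1), ∀ i : Fin (2 * n + 1), i ≠ r → ∃ k ≤ N,
      ((2 * n + 1 : ℕ) * k + (i : ℕ) + 1 : ℝ) ≤ (2 * n + 1 : ℕ) * N * x j + (2 * n + 1 : ℕ) ∧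
      ((2 * n + 1 : ℕ) * N * x j : ℝ) ≤ (2 * n + 1 : ℕ) * k + (i : ℕ) := fun j =>
    exists_forall_ne_mem_plateau (Nat.succ_pos _) (mul_nonneg (by positivity) (x j).2.1)
      (mul_le_of_le_one_right (by positivity) (x j).2.2)
  choose r hr using hx
  let bad := Finset.univ.image r
  have hbad : (bad.card : ℝ) ≤ n := by
    exact_mod_cast Finset.card_image_le.trans (by simp)
  have hterm : ∀ i, |f x / d - h (∑ j, lam j * ψ i (x j))| ≤
      M / (2 * d) / d + if i ∈ bad then 2 * M / d else 0 := by
    intro i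
    split_ifs with hi
    · have h₁ : |f x / d| ≤ M / d := by
        rw [abs_div, abs_of_pos hd₀]
        gcongr
        exact f.norm_coe_le_norm x
      have h₂ : |h (∑ j, lam j * ψ i (x j))| ≤ M / d := (h.norm_coe_le_norm _).trans hhM
      have h₃ := abs_sub (f x / d) (h (∑ j, lam j * ψ i (x j)))
      have : 2 * M / d = M / d + M / d := by ring
      have : 0 ≤ M / (2 * d) / d := by positivity
      linarith
    · have hi' : ∀ j, i ≠ r j := fun j hij =>
        hi (hij ▸ Finset.mem_image_of_mem r (Finset.mem_univ j))
      choose k hk hk₁ hk₂ using fun j => hr j i (hi' j)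
      have hval := congrFun hhe (i, fun j => ⟨k j, Nat.lt_succ_of_le (hk j)⟩)
      have hsum : ∑ j, lam j * ψ i (x j) = e (i, fun j => ⟨k j, Nat.lt_succ_of_le (hk j)⟩) :=
        Finset.sum_congr rfl fun j _ => by rw [hψ i (k j) (hk j) (x j) (hk₁ j) (hk₂ j)]
      rw [hsum, show h (e _) = f (fun j => gridPoint N (k j)) / d from hval, ← sub_div, abs_div,
        abs_of_pos hd₀, add_zero]
      gcongr
      refine hf _ _ ((dist_pi_le_iff (by positivity)).2 fun j => ?_)
      rw [Subtype.dist_eq, Real.dist_eq, coe_gridPoint hN (hk j)]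
      have hi₁ : ((i : ℕ) : ℝ) + 1 ≤ d := by rw [← hd]; exact_mod_cast i.2
      have hi₀ : (0 : ℝ) ≤ (i : ℕ) := by positivity
      have a₁ := hk₁ j
      have a₂ := hk₂ j
      rw [hd] at a₁ a₂
      have e₁ : (x j : ℝ) - k j / N = (d * N * x j - d * k j) / (d * N) := by field_simp
      have e₂ : (1 : ℝ) / N = d / (d * N) := by field_simp
      rw [e₁, e₂, abs_div, abs_of_pos (mul_pos hd₀ hN')]
      gcongr
      rw [abs_le]
      constructor <;> linarith
  have hfx : f x = ∑ _i : Fin (2 * n + 1), f x / d := by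
    rw [Finset.sum_const, Finset.card_univ, Fintype.card_fin, nsmul_eq_mul, hd]
    field_simp
  rw [ContinuousMap.sub_apply, superposition_apply, hfx, ← Finset.sum_sub_distrib]
  calc _ ≤ ∑ i, (M / (2 * d) / d + if i ∈ bad then 2 * M / d else 0) :=
        norm_sum_le_of_le _ fun i _ => hterm i
    _ = d * (M / (2 * d) / d) + bad.card * (2 * M / d) := by
        rw [Finset.sum_add_distrib, Finset.sum_const, Finset.card_univ, Fintype.card_fin,
          nsmul_eq_mul, hd, Finset.sum_ite_mem, Finset.univ_inter, Finset.sum_const, nsmul_eq_mul]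
    _ ≤ d * (M / (2 * d) / d) + n * (2 * M / d) := by gcongr
    _ = (1 - 1 / (2 * (2 * n + 1))) * M := by
        simp only [d]
        field_simp
        ring

/-- Inner functions admitting an outer function that reduces `f` by a fixed factor are dense. -/
theorem exists_near_superposition_approx {n : ℕ} (hn : 1 ≤ n) {lam : Fin n → ℝ}
    (hlam : ∀ a b : Fin n → ℕ, ∑ j, lam j * a j = ∑ j, lam j * b j → a = b)
    {f : C(Fin n → I, ℝ)} (hf : f ≠ 0) {φ : Fin (2 * n + 1) → C(I, ℝ)}
    (hφ : ∀ i, φ i ∈ monotoneSelfMaps) {ε : ℝ} (hε : 0 < ε) :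
    ∃ ψ : Fin (2 * n + 1) → C(I, ℝ), (∀ i, ψ i ∈ monotoneSelfMaps) ∧ (∀ i, dist (ψ i) (φ i) < ε) ∧
      ∃ h : ℝ →ᵇ ℝ, ‖h‖ ≤ ‖f‖ ∧
        ‖f - superposition lam ψ h‖ ≤ (1 - 1 / (2 * (2 * n + 1))) * ‖f‖ := by
  have hf₀ : 0 < ‖f‖ := norm_pos_iff.2 hf
  obtain ⟨δ₁, hδ₁, h₁⟩ := Metric.uniformContinuous_iff.1
    (CompactSpace.uniformContinuous_of_continuous f.continuous) (‖f‖ / (2 * (2 * n + 1)))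
    (by positivity)
  obtain ⟨δ₂, hδ₂, h₂⟩ := Metric.uniformContinuous_iff.1
    (CompactSpace.uniformContinuous_of_continuous (f := fun x i => φ i x) (by fun_prop)) (ε / 4)
    (by positivity)
  obtain ⟨N, hN⟩ := exists_nat_one_div_lt (lt_min hδ₁ hδ₂)
  have hN' : 1 / ((N + 1 : ℕ) : ℝ) < min δ₁ δ₂ := by exact_mod_cast hN
  obtain ⟨ψ, m, c, hc, hψ, hψφ, hm, hval⟩ := exists_plateau_family N.succ_pos hφ
    (δ := ε / 4) (by positivity) fun i x y hxy =>
      (dist_le_pi_dist (fun i => φ i x) (fun i => φ i y) i).trans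
        (h₂ (hxy.trans_lt (hN'.trans_le (min_le_right _ _)))).le
  refine ⟨ψ, hψ, fun i => ?_, exists_superposition_approx hn N.succ_pos hlam hc hm hval f
    fun x y hxy => (h₁ (hxy.trans_lt (hN'.trans_le (min_le_left _ _)))).le⟩
  refine ((ContinuousMap.dist_le (by positivity)).2 fun x => hψφ i x).trans_lt (by linarith)

/-- For generic inner functions, every `f ≠ 0` is reduced by a fixed factor by some `h`. -/
theorem superposition_approx_mem_residual {n : ℕ} (hn : 1 ≤ n) {lam : Fin n → ℝ}
    (hlam : ∀ a b : Fin n → ℕ, ∑ j, lam j * a j = ∑ j, lam j * b j → a = b)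
    {f : C(Fin n → I, ℝ)} (hf : f ≠ 0) :
    {φ : Fin (2 * n + 1) → monotoneSelfMaps | ∃ h : ℝ →ᵇ ℝ, ‖h‖ ≤ ‖f‖ ∧
      ‖f - superposition lam (fun i => φ i) h‖ < (1 - 1 / (4 * (2 * n + 1))) * ‖f‖} ∈
      residual (Fin (2 * n + 1) → monotoneSelfMaps) := by
  have hf₀ : 0 < ‖f‖ := norm_pos_iff.2 hf
  refine residual_of_dense_open ?_ (Metric.dense_iff.2 fun φ ε hε => ?_)
  · have : ∀ h : ℝ →ᵇ ℝ, IsOpen {φ : Fin (2 * n + 1) → monotoneSelfMaps | ‖h‖ ≤ ‖f‖ ∧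
        ‖f - superposition lam (fun i => φ i) h‖ < (1 - 1 / (4 * (2 * n + 1))) * ‖f‖} := by
      intro h
      refine IsOpen.and isOpen_const (isOpen_lt ?_ continuous_const)
      have := (continuous_superposition (D := 2 * n + 1) lam h).comp
        (f := fun (φ : Fin (2 * n + 1) → monotoneSelfMaps) i => (φ i : C(I, ℝ))) (by fun_prop)
      exact (continuous_const.sub this).norm
    convert isOpen_iUnion this using 1
    ext φ
    simp
  · obtain ⟨ψ, hψ, hdist, h, hh, hfh⟩ :=
      exists_near_superposition_approx hn hlam hf (fun i => (φ i).2) hε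
    refine ⟨fun i => ⟨ψ i, hψ i⟩, (dist_pi_lt_iff hε).2 hdist, h, hh, hfh.trans_lt ?_⟩
    gcongr
    norm_num

/-- Generic inner functions increase strictly between two given points. -/
theorem lt_mem_residual {ι : Type*} [Fintype ι] {a b : I} (hab : a < b) :
    {φ : ι → monotoneSelfMaps | ∀ i, (φ i : C(I, ℝ)) a < (φ i : C(I, ℝ)) b} ∈
      residual (ι → monotoneSelfMaps) := by
  refine residual_of_dense_open ?_ (Metric.dense_iff.2 fun φ ε hε => ?_)
  · simp only [ofPred_forall]
    exact isOpen_iInter_of_finite fun i => isOpen_lt (by fun_prop) (by fun_prop)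
  · obtain ⟨s, hs₀, hs⟩ := exists_between (lt_min hε one_pos)
    obtain ⟨hsε, hs₁⟩ := lt_min_iff.1 hs
    have hs₁' : 0 ≤ 1 - s := by linarith
    let ψ : ι → C(I, ℝ) := fun i => ⟨fun x => (1 - s) * (φ i : C(I, ℝ)) x + s * x, by fun_prop⟩
    have hψ : ∀ i, ψ i ∈ monotoneSelfMaps := by
      refine fun i => ⟨fun x y hxy => ?_, fun x => ?_⟩
      · have h₁ : (φ i : C(I, ℝ)) x ≤ (φ i : C(I, ℝ)) y := (φ i).2.1 hxy
        have h₂ : (x : ℝ) ≤ y := hxy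
        simp only [ψ, ContinuousMap.coe_mk]
        gcongr
      · exact convex_Icc (0 : ℝ) 1 ((φ i).2.2 x) x.2 hs₁' hs₀.le (by ring)
    refine ⟨fun i => ⟨ψ i, hψ i⟩, (dist_pi_lt_iff hε).2 fun i => ?_, fun i => ?_⟩
    · refine ((ContinuousMap.dist_le hs₀.le).2 fun x => ?_).trans_lt hsε
      have h₁ := (φ i).2.2 x
      have h₂ := x.2
      have e : (1 - s) * (φ i : C(I, ℝ)) x + s * x - (φ i : C(I, ℝ)) x
        = s * (x - (φ i : C(I, ℝ)) x) := by ring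
      simp only [ψ, ContinuousMap.coe_mk]
      rw [Real.dist_eq, e, abs_mul, abs_of_pos hs₀]
      refine mul_le_of_le_one_right hs₀.le (abs_le.2 ⟨?_, ?_⟩) <;> linarith [h₁.1, h₁.2, h₂.1, h₂.2]
    · have h₁ : (φ i : C(I, ℝ)) a ≤ (φ i : C(I, ℝ)) b := (φ i).2.1 hab.le
      have h₂ : (a : ℝ) < b := hab
      simp only [ψ, ContinuousMap.coe_mk]
      exact add_lt_add_of_le_of_lt (by gcongr) (by gcongr)

/-- Some strictly increasing inner functions represent every continuous function on the cube. -/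
theorem exists_superposition_surjective {n : ℕ} (hn : 1 ≤ n) {lam : Fin n → ℝ}
    (hlam : ∀ a b : Fin n → ℕ, ∑ j, lam j * a j = ∑ j, lam j * b j → a = b) :
    ∃ φ : Fin (2 * n + 1) → C(I, ℝ), (∀ i, StrictMono (φ i) ∧ ∀ x, φ i x ∈ Icc (0 : ℝ) 1) ∧
      Function.Surjective (superposition lam φ) := by
  have : CompleteSpace monotoneSelfMaps := isClosed_monotoneSelfMaps.completeSpace_coe
  have : Nonempty monotoneSelfMaps :=
    ⟨0, fun _ _ _ => le_rfl, fun _ => ⟨le_rfl, zero_le_one⟩⟩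
  let F := TopologicalSpace.denseSeq C(Fin n → I, ℝ)
  let p := TopologicalSpace.denseSeq I
  have hF : ∀ᶠ φ in residual (Fin (2 * n + 1) → monotoneSelfMaps), ∀ k, F k ≠ 0 →
      ∃ h : ℝ →ᵇ ℝ, ‖h‖ ≤ ‖F k‖ ∧
        ‖F k - superposition lam (fun i => φ i) h‖ < (1 - 1 / (4 * (2 * n + 1))) * ‖F k‖ := by
    refine eventually_countable_forall.2 fun k => ?_
    by_cases hk : F k = 0
    · exact Filter.Eventually.of_forall fun _ h => absurd hk h
    · filter_upwards [superposition_approx_mem_residual hn hlam hk] with φ hφ _ using hφ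
  have hp : ∀ᶠ φ in residual (Fin (2 * n + 1) → monotoneSelfMaps), ∀ k l, p k < p l →
      ∀ i, (φ i : C(I, ℝ)) (p k) < (φ i : C(I, ℝ)) (p l) := by
    refine eventually_countable_forall.2 fun k => eventually_countable_forall.2 fun l => ?_
    by_cases hkl : p k < p l
    · filter_upwards [lt_mem_residual hkl] with φ hφ _ using hφ
    · exact Filter.Eventually.of_forall fun _ h => absurd h hkl
  obtain ⟨φ, hφF, hφp⟩ := (dense_of_mem_residual (hF.and hp)).nonempty
  refine ⟨fun i => φ i, fun i => ⟨fun x y hxy => ?_, (φ i).2.2⟩, ?_⟩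
  · obtain ⟨_, ⟨k, rfl⟩, hxk, hky⟩ := (TopologicalSpace.denseRange_denseSeq I).exists_between hxy
    obtain ⟨_, ⟨l, rfl⟩, hkl, hly⟩ := (TopologicalSpace.denseRange_denseSeq I).exists_between hky
    exact ((φ i).2.1 hxk.le).trans_lt ((hφp k l hkl i).trans_le ((φ i).2.1 hly.le))
  · set q : ℝ := 1 / (4 * (2 * n + 1))
    have hq₀ : 0 < q := by positivity
    have hq₁ : q ≤ 1 := by
      refine div_le_one_of_le₀ ?_ (by positivity)
      linarith [(Nat.cast_nonneg n : (0 : ℝ) ≤ n)]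
    refine ContinuousLinearMap.surjective_of_approx_preimage _ (C := 2) (θ := 1 - q / 2)
      (by linarith) (by linarith) zero_le_two fun f => ?_
    rcases eq_or_ne f 0 with rfl | hf
    · exact ⟨0, by simp⟩
    have hf₀ : 0 < ‖f‖ := norm_pos_iff.2 hf
    obtain ⟨k, hk⟩ := (TopologicalSpace.denseRange_denseSeq C(Fin n → I, ℝ)).exists_dist_lt f
      (ε := q / 4 * ‖f‖) (by positivity)
    rw [dist_eq_norm] at hk
    change ‖f - F k‖ < _ at hk
    have h₁ : ‖F k‖ ≤ (1 + q / 4) * ‖f‖ := by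
      have := norm_le_norm_add_norm_sub f (F k)
      linarith
    have h₂ : F k ≠ 0 := by
      intro h0
      rw [h0, sub_zero] at hk
      nlinarith
    obtain ⟨h, hh, hfh⟩ := hφF k h₂
    refine ⟨h, by nlinarith, ?_⟩
    have h₃ := norm_sub_le_norm_sub_add_norm_sub f (F k) (superposition lam (fun i => φ i) h)
    have h₄ : (1 - q) * ‖F k‖ ≤ (1 - q) * ((1 + q / 4) * ‖f‖) :=
      mul_le_mul_of_nonneg_left h₁ (by linarith)
    nlinarith [mul_pos (mul_pos hq₀ hq₀) hf₀]

/-- Kolmogorov superposition theorem: every continuous function on `[0,1]^n` can be written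
as `u(x) = Σ_{i=1}^{2n+1} h(Σ_{j=1}^n λ_j φ_i(x_j))`. -/
theorem kolmogorov_superposition (n : ℕ) (hn : 1 ≤ n) :
    ∃ (lam : Fin n → ℝ) (φ : Fin (2 * n + 1) → ℝ → ℝ),
      (∀ j, 0 < lam j) ∧ (∑ j, lam j ≤ 1) ∧
      (∀ i, ContinuousOn (φ i) (Set.Icc (0 : ℝ) 1) ∧
        StrictMonoOn (φ i) (Set.Icc (0 : ℝ) 1) ∧
        Set.MapsTo (φ i) (Set.Icc (0 : ℝ) 1) (Set.Icc (0 : ℝ) 1)) ∧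
      ∀ u : (Fin n → ℝ) → ℝ,
        ContinuousOn u (Set.Icc (0 : Fin n → ℝ) 1) →
        ∃ h : ℝ → ℝ, ContinuousOn h (Set.Icc (0 : ℝ) 1) ∧
          ∀ x ∈ Set.Icc (0 : Fin n → ℝ) 1,
            u x = ∑ i, h (∑ j, lam j * φ i (x j)) := by
  obtain ⟨lam, hpos, hsum, hinj⟩ := exists_pos_weights_injective n hn
  obtain ⟨φ, hφ, hsurj⟩ := exists_superposition_surjective hn hinj
  refine ⟨lam, fun i => IccExtend zero_le_one (φ i), hpos, hsum, fun i => ⟨?_, ?_, ?_⟩, ?_⟩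
  · exact (φ i).continuous.Icc_extend'.continuousOn
  · exact (hφ i).1.strictMonoOn_IccExtend zero_le_one
  · exact fun x _ => (hφ i).2 _
  · intro u hu
    let f : C(Fin n → I, ℝ) := ⟨fun x => u fun j => x j,
      hu.comp_continuous (by fun_prop) fun x => ⟨fun j => (x j).2.1, fun j => (x j).2.2⟩⟩
    obtain ⟨h, hh⟩ := hsurj f
    refine ⟨h, h.continuous.continuousOn, fun x hx => ?_⟩
    have hxI : ∀ j, x j ∈ Icc (0 : ℝ) 1 := fun j => ⟨hx.1 j, hx.2 j⟩
    have := DFunLike.congr_fun hh fun j => (⟨x j, hxI j⟩ : I)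
    rw [superposition_apply] at this
    simp only [IccExtend_of_mem zero_le_one _ (hxI _)]
    exact this.symm
end

section
/- (Maiorov–Pinkus) For every n ≥ 1 there exists a real-analytic, strictly increasing function σ : ℝ → ℝ such that for every continuous function u : [0,1]^n → ℝ and every ε > 0 there exist real constants d_i, c_{ij}, θ_{ij}, γ_i (for 1 ≤ i ≤ 6n+3, 1 ≤ j ≤ 3n) and vectors w^{ij} ∈ ℝ^n such that | u(x) − Σ_{i=1}^{6n+3} d_i σ( Σ_{j=1}^{3n} c_{ij} σ( w^{ij}·x − θ_{ij} ) − γ_i ) | < ε for all x ∈ [0,1]^n. -/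
open scoped RealInnerProductSpace
open Filter Topology Polynomial

/-- A real polynomial times a Gaussian. -/
noncomputable def gaussTerm (p : ℝ[X]) (x : ℝ) : ℝ := p.eval x * Real.exp (-x ^ 2)

/-- The entire extension of `gaussTerm`. -/
noncomputable def complexGaussTerm (p : ℝ[X]) (z : ℂ) : ℂ :=
  (p.map Complex.ofRealHom).eval z * Complex.exp (-z ^ 2)

lemma complexGaussTerm_ofReal (p : ℝ[X]) (x : ℝ) :
    complexGaussTerm p x = (gaussTerm p x : ℝ) := by
  have : (p.map Complex.ofRealHom).eval (x : ℂ) = ((p.eval x : ℝ) : ℂ) := by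
    simpa using Polynomial.eval_map_apply (p := p) (f := Complex.ofRealHom) x
  rw [complexGaussTerm, gaussTerm, this]
  push_cast
  rfl

lemma differentiable_complexGaussTerm (p : ℝ[X]) : Differentiable ℂ (complexGaussTerm p) := by
  unfold complexGaussTerm
  exact (Polynomial.differentiable _).mul (by fun_prop)

lemma tendsto_norm_eval_mul_exp_neg_sq (p : ℂ[X]) :
    Tendsto (fun z => ‖p.eval z‖ * Real.exp (-‖z‖ ^ 2)) (cocompact ℂ) (𝓝 0) := by
  induction p using Polynomial.induction_on' with
  | add p q hp hq =>
    refine squeeze_zero (fun z => by positivity) (fun z => ?_) (by simpa using hp.add hq)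
    rw [eval_add, ← add_mul]
    gcongr
    exact norm_add_le _ _
  | monomial n a =>
    have h1 : Tendsto (fun z : ℂ => ‖z‖) (cocompact ℂ) atTop := tendsto_norm_cocompact_atTop
    have h2 := ((Real.tendsto_pow_mul_exp_neg_atTop_nhds_zero n).comp h1).const_mul ‖a‖
    rw [mul_zero] at h2
    refine squeeze_zero' (.of_forall fun z => by positivity) ?_ h2
    filter_upwards [h1.eventually_ge_atTop 1] with z hz
    simp only [eval_monomial, norm_mul, norm_pow, Function.comp_apply, mul_assoc]
    gcongr
    nlinarith

lemma norm_complexGaussTerm (p : ℝ[X]) (z : ℂ) : ‖complexGaussTerm p z‖ =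
    Real.exp (2 * z.im ^ 2) *
      (‖(p.map Complex.ofRealHom).eval z‖ * Real.exp (-‖z‖ ^ 2)) := by
  rw [complexGaussTerm, norm_mul, Complex.norm_exp, mul_left_comm, ← Real.exp_add]
  congr 2
  rw [← Complex.normSq_eq_norm_sq, Complex.normSq_apply]
  simp [pow_two]
  ring

lemma eventually_norm_complexGaussTerm_le (p : ℝ[X]) (R : ℝ) {ε : ℝ} (hε : 0 < ε) :
    ∀ᶠ c : ℝ in atTop, ∀ z : ℂ, ‖z‖ ≤ R →
      ‖complexGaussTerm p (z - c)‖ ≤ ε ∧ ‖complexGaussTerm p (z + c)‖ ≤ ε := by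
  have h := (tendsto_norm_eval_mul_exp_neg_sq (p.map Complex.ofRealHom)).eventually
    (ge_mem_nhds (div_pos hε (Real.exp_pos (2 * R ^ 2))))
  rw [← Metric.cobounded_eq_cocompact, ← comap_norm_atTop, eventually_comap,
    eventually_atTop] at h
  obtain ⟨ρ, hρ⟩ := h
  have key : ∀ w : ℂ, ρ ≤ ‖w‖ → |w.im| ≤ R → ‖complexGaussTerm p w‖ ≤ ε := by
    intro w hw hi
    have h1 := hρ _ hw w rfl
    rw [le_div_iff₀ (Real.exp_pos _)] at h1
    rw [norm_complexGaussTerm]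
    have h2 : Real.exp (2 * w.im ^ 2) ≤ Real.exp (2 * R ^ 2) := by
      have := sq_le_sq' (abs_le.mp hi).1 (abs_le.mp hi).2
      gcongr
    refine le_trans ?_ h1
    rw [mul_comm]
    gcongr
  filter_upwards [eventually_ge_atTop (ρ + R), eventually_ge_atTop 0] with c hc hc0 z hz
  have hcn : ‖(c : ℂ)‖ = c := by simp [abs_of_nonneg hc0]
  have him := (Complex.abs_im_le_norm z).trans hz
  refine ⟨key _ ?_ (by simpa using him), key _ ?_ (by simpa using him)⟩
  · have := norm_sub_norm_le (c : ℂ) z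
    rw [norm_sub_rev] at this
    linarith
  · have := norm_sub_norm_le (c : ℂ) (-z)
    rw [sub_neg_eq_add, norm_neg, add_comm (c : ℂ)] at this
    linarith

lemma exists_abs_gaussTerm_le (p : ℝ[X]) : ∃ C, ∀ x, |gaussTerm p x| ≤ C := by
  obtain ⟨D, hD⟩ := eventually_atTop.mp (eventually_norm_complexGaussTerm_le p 0 one_pos)
  have hc : Continuous (gaussTerm p) := by unfold gaussTerm; fun_prop
  obtain ⟨C, hC⟩ := (isCompact_Icc (a := -D) (b := D)).exists_bound_of_continuousOn hc.continuousOn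
  refine ⟨max C 1, fun x => ?_⟩
  rw [← Real.norm_eq_abs, ← Complex.norm_real, ← complexGaussTerm_ofReal]
  by_cases h : x ∈ Set.Icc (-D) D
  · rw [complexGaussTerm_ofReal, Complex.norm_real]
    exact (hC x h).trans (le_max_left _ _)
  · refine le_max_of_le_right ?_
    rcases le_total D x with h' | h'
    · simpa using (hD x h' 0 (by simp)).2
    · have : x < -D := by
        by_contra! h''
        exact h ⟨h'', h'⟩
      simpa using (hD (-x) (by linarith) 0 (by simp)).1

lemma tendsto_gaussTerm_atBot (p : ℝ[X]) : Tendsto (gaussTerm p) atBot (𝓝 0) := by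
  rw [Metric.tendsto_nhds]
  intro ε hε
  have h := tendsto_neg_atBot_atTop.eventually
    (eventually_norm_complexGaussTerm_le p 0 (half_pos hε))
  filter_upwards [h] with x hx
  have h1 := (hx 0 (by simp)).1
  simp only [Complex.ofReal_neg, sub_neg_eq_add, zero_add] at h1
  rw [complexGaussTerm_ofReal, Complex.norm_real] at h1
  rw [dist_zero_right]
  linarith

lemma exists_lipschitz_gaussTerm (p : ℝ[X]) :
    ∃ C, ∀ x y, |gaussTerm p x - gaussTerm p y| ≤ C * |x - y| := by
  obtain ⟨C, hC⟩ := exists_abs_gaussTerm_le (derivative p - 2 * X * p)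
  refine ⟨C, fun x y => ?_⟩
  refine Convex.norm_image_sub_le_of_norm_hasDerivWithin_le (s := Set.univ)
    (f' := gaussTerm (derivative p - 2 * X * p)) (fun t _ => ?_) (fun t _ => hC t) convex_univ
    (Set.mem_univ y) (Set.mem_univ x)
  have h1 := (p.hasDerivAt t).mul ((hasDerivAt_pow 2 t).neg.exp)
  refine (h1.congr_deriv ?_).hasDerivWithinAt
  simp [gaussTerm]
  ring

lemma exists_gaussTerm_approx (p : ℝ[X]) {e κ : ℝ} (he : 0 < e) (hκ : 0 < κ) :
    ∃ (q : ℝ[X]) (a δ : ℝ), 0 < a ∧ 0 < δ ∧ δ ≤ 1 ∧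
      (∀ s ∈ Set.Icc (-1 : ℝ) 1, |gaussTerm q (δ * s) - a * p.eval s| ≤ a * e) ∧
      (∀ x, |gaussTerm q x| ≤ κ) ∧ ∀ x y, |gaussTerm q x - gaussTerm q y| ≤ κ * |x - y| := by
  obtain ⟨C, hC⟩ := (isCompact_Icc (a := (-1 : ℝ)) (b := 1)).exists_bound_of_continuousOn
    p.continuous.continuousOn
  have hC0 : 0 ≤ C := (norm_nonneg _).trans (hC 0 (by simp))
  set δ := min 1 (e / (C + 1)) with hδ
  have hδ0 : 0 < δ := by positivity
  have hδ1 : δ ≤ 1 := min_le_left _ _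
  have hδC : C * δ ≤ e := by
    have : δ ≤ e / (C + 1) := min_le_right _ _
    rw [le_div_iff₀ (by positivity)] at this
    nlinarith
  obtain ⟨A, hA⟩ := exists_abs_gaussTerm_le (p.comp (Polynomial.C δ⁻¹ * X))
  obtain ⟨B, hB⟩ := exists_lipschitz_gaussTerm (p.comp (Polynomial.C δ⁻¹ * X))
  have hA0 : 0 ≤ A := (abs_nonneg _).trans (hA 0)
  set a := κ / (max A B + 1) with ha
  have hAB : 0 ≤ max A B := le_max_of_le_left hA0
  have ha0 : 0 < a := by positivity
  have haAB : a * max A B ≤ κ := by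
    rw [ha, div_mul_eq_mul_div, div_le_iff₀ (by positivity)]
    nlinarith
  have hmul : ∀ x, gaussTerm (Polynomial.C a * p.comp (Polynomial.C δ⁻¹ * X)) x =
      a * gaussTerm (p.comp (Polynomial.C δ⁻¹ * X)) x := by
    intro x; simp [gaussTerm, mul_assoc]
  refine ⟨Polynomial.C a * p.comp (Polynomial.C δ⁻¹ * X), a, δ, ha0, hδ0, hδ1, ?_, ?_, ?_⟩
  · intro s hs
    rw [hmul, ← mul_sub, abs_mul, abs_of_pos ha0]
    gcongr
    have e1 : gaussTerm (p.comp (Polynomial.C δ⁻¹ * X)) (δ * s) - p.eval s =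
        p.eval s * (Real.exp (-(δ * s) ^ 2) - 1) := by
      simp only [gaussTerm, eval_comp, eval_mul, eval_C, eval_X]
      rw [inv_mul_cancel_left₀ hδ0.ne']
      ring
    rw [e1, abs_mul]
    have h1 : |Real.exp (-(δ * s) ^ 2) - 1| ≤ δ := by
      have h2 := Real.add_one_le_exp (-(δ * s) ^ 2)
      have h3 : Real.exp (-(δ * s) ^ 2) ≤ 1 :=
        Real.exp_le_one_iff.mpr (by nlinarith [sq_nonneg (δ * s)])
      have h4 : (δ * s) ^ 2 ≤ δ := by
        have : s ^ 2 ≤ 1 := by nlinarith [hs.1, hs.2]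
        rw [mul_pow]
        nlinarith [sq_nonneg s, sq_nonneg δ]
      rw [abs_le]
      constructor <;> linarith
    calc |p.eval s| * |Real.exp (-(δ * s) ^ 2) - 1| ≤ C * δ := by
          gcongr
          exact hC s hs
      _ ≤ e := hδC
  · intro x
    rw [hmul, abs_mul, abs_of_pos ha0]
    refine le_trans ?_ haAB
    gcongr
    exact (hA x).trans (le_max_left _ _)
  · intro x y
    rw [hmul, hmul, ← mul_sub, abs_mul, abs_of_pos ha0]
    calc a * _ ≤ a * (max A B * |x - y|) := by
          gcongr
          refine (hB x y).trans ?_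
          gcongr
          exact le_max_right _ _
      _ ≤ κ * |x - y| := by
          rw [← mul_assoc]
          gcongr

lemma exists_centers (q : ℕ → ℝ[X]) {b : ℕ → ℝ} (hb : ∀ i, 0 < b i) :
    ∃ c : ℕ → ℝ,
      (∀ (m : ℕ) (z : ℂ), ‖z‖ ≤ m → ‖complexGaussTerm (q m) (z - c m)‖ ≤ (1 / 2) ^ m) ∧
      ∀ i j, i ≠ j → ∀ x : ℝ, |x| ≤ 1 →
        |gaussTerm (q j) (x + c i - c j)| ≤ (1 / 2) ^ j * b i := by
  have h : ∀ m : ℕ, ∀ᶠ c : ℝ in atTop,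
      (∀ z : ℂ, ‖z‖ ≤ m → ‖complexGaussTerm (q m) (z - c)‖ ≤ (1 / 2) ^ m) ∧
      ∀ j ∈ Finset.range m, ∀ z : ℂ, ‖z‖ ≤ 1 →
        ‖complexGaussTerm (q m) (z - c)‖ ≤ (1 / 2) ^ m * b j ∧
        ‖complexGaussTerm (q j) (z + c)‖ ≤ (1 / 2) ^ j * b m := by
    intro m
    refine Eventually.and ?_ ((Filter.eventually_all_finset _).mpr fun j _ => ?_)
    · filter_upwards [eventually_norm_complexGaussTerm_le (q m) m
        (by positivity : (0 : ℝ) < (1 / 2) ^ m)] with c hc z hz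
      exact (hc z hz).1
    · filter_upwards [eventually_norm_complexGaussTerm_le (q m) 1
        (mul_pos (by positivity : (0 : ℝ) < (1 / 2) ^ m) (hb j)),
        eventually_norm_complexGaussTerm_le (q j) 1
        (mul_pos (by positivity : (0 : ℝ) < (1 / 2) ^ j) (hb m))] with c hc hc' z hz
      exact ⟨(hc z hz).1, (hc' z hz).2⟩
  simp only [eventually_atTop] at h
  choose D hD using h
  set c : ℕ → ℝ := fun m => ∑ j ∈ Finset.range (m + 1), |D j| with hc
  have hsep : ∀ j m, j < m → D m ≤ c m - c j := by
    intro j m hjm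
    have h1 : c j ≤ ∑ j ∈ Finset.range m, |D j| :=
      Finset.sum_le_sum_of_subset_of_nonneg (Finset.range_mono hjm) fun _ _ _ => abs_nonneg _
    have h2 : c m = (∑ j ∈ Finset.range m, |D j|) + |D m| := Finset.sum_range_succ _ _
    linarith [le_abs_self (D m)]
  refine ⟨c, fun m z hz => (hD m (c m) ?_).1 z hz, fun i j hij x hx => ?_⟩
  · exact (le_abs_self _).trans (Finset.single_le_sum (f := fun j => |D j|)
      (fun _ _ => abs_nonneg _) (Finset.self_mem_range_succ m))
  · have hx' : ‖(x : ℂ)‖ ≤ 1 := by simpa using hx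
    rw [← Real.norm_eq_abs, ← Complex.norm_real, ← complexGaussTerm_ofReal]
    rcases lt_or_gt_of_ne hij with h | h
    · have := ((hD j _ (hsep i j h)).2 i (Finset.mem_range.mpr h) x hx').1
      convert this using 3
      push_cast; ring
    · have := ((hD i _ (hsep j i h)).2 j (Finset.mem_range.mpr h) x hx').2
      convert this using 3
      push_cast; ring

lemma analyticOnNhd_tsum_gaussTerm {q : ℕ → ℝ[X]} {c : ℕ → ℝ}
    (h : ∀ (m : ℕ) (z : ℂ), ‖z‖ ≤ m → ‖complexGaussTerm (q m) (z - c m)‖ ≤ (1 / 2) ^ m) :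
    AnalyticOnNhd ℝ (fun x => ∑' i, gaussTerm (q i) (x - c i)) Set.univ := by
  have hd : Differentiable ℂ fun z => ∑' i, complexGaussTerm (q i) (z - c i) := by
    intro w
    have hF : ∀ i, Differentiable ℂ fun z => complexGaussTerm (q i) (z - c i) := fun i =>
      (differentiable_complexGaussTerm _).comp (differentiable_id.sub_const _)
    obtain ⟨N, hN⟩ := exists_nat_gt ‖w‖
    have hw : w ∈ Metric.ball (0 : ℂ) N := by simpa using hN
    have hC : ∀ i, ∃ C, ∀ z ∈ Metric.closedBall (0 : ℂ) N,
        ‖complexGaussTerm (q i) (z - c i)‖ ≤ C := fun i =>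
      (isCompact_closedBall _ _).exists_bound_of_continuousOn (hF i).continuous.continuousOn
    choose C hC using hC
    refine ((Complex.differentiableOn_tsum_of_summable_norm
      (u := fun i => if i < N then C i else (1 / 2) ^ i) ?_ (fun i => (hF i).differentiableOn)
      Metric.isOpen_ball fun i z hz => ?_) w hw).differentiableAt (Metric.isOpen_ball.mem_nhds hw)
    · refine (summable_congr_atTop ?_).mpr summable_geometric_two
      filter_upwards [eventually_ge_atTop N] with i hi
      simp [not_lt.mpr hi]
    · split_ifs with hi
      · exact hC i z (Metric.ball_subset_closedBall hz)
      · refine h i z ?_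
        have : ‖z‖ < N := by simpa using hz
        have : (N : ℝ) ≤ i := by exact_mod_cast not_lt.mp hi
        linarith
  intro x _
  have h1 := (hd.analyticAt (x : ℂ)).re_ofReal
  refine h1.congr (.of_forall fun y => ?_)
  simp only [← Complex.ofReal_sub, complexGaussTerm_ofReal]
  rw [← Complex.ofReal_tsum, Complex.ofReal_re]

/-- An analytic function that reproduces, up to affine changes of variable and a positive factor,
each member of a given sequence of polynomials on `[-1, 1]` with a prescribed accuracy. -/
lemma exists_analytic_reproducing (p : ℕ → ℝ[X]) {e : ℕ → ℝ} (he : ∀ i, 0 < e i) :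
    ∃ T : ℝ → ℝ, AnalyticOnNhd ℝ T Set.univ ∧ (∀ x y, |T x - T y| ≤ 1 / 2 * |x - y|) ∧
      Tendsto T atBot (𝓝 0) ∧ ∀ i, ∃ a c δ : ℝ, 0 < a ∧
        ∀ s ∈ Set.Icc (-1 : ℝ) 1, |T (c + δ * s) - a * (p i).eval s| ≤ a * e i := by
  have hterm := fun i => exists_gaussTerm_approx (p i) (half_pos (he i))
    (by positivity : (0 : ℝ) < 1 / 4 * (1 / 2) ^ i)
  choose q a δ ha hδ hδ1 happ hbd hlip using hterm
  obtain ⟨c, hc, hcross⟩ := exists_centers q (b := fun i => a i * e i / 4) fun i => by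
    have := ha i; have := he i; positivity
  have hgeo : HasSum (fun i : ℕ => (1 / 2 : ℝ) ^ i) 2 := hasSum_geometric_two
  have hsum : ∀ x, Summable fun i => gaussTerm (q i) (x - c i) := fun x =>
    (hgeo.summable.mul_left (1 / 4)).of_norm_bounded fun i => hbd i _
  refine ⟨fun x => ∑' i, gaussTerm (q i) (x - c i), analyticOnNhd_tsum_gaussTerm hc, ?_, ?_, ?_⟩
  · intro x y
    rw [← (hsum x).tsum_sub (hsum y)]
    have h1 := (hgeo.mul_left (1 / 4)).mul_right |x - y|
    have e1 : (1 / 4 * 2 : ℝ) = 1 / 2 := by norm_num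
    rw [e1] at h1
    rw [← Real.norm_eq_abs]
    refine tsum_of_norm_bounded h1 fun i => ?_
    simpa using hlip i (x - c i) (y - c i)
  · have h0 : ∀ i, Tendsto (fun x => gaussTerm (q i) (x - c i)) atBot (𝓝 0) := fun i =>
      (tendsto_gaussTerm_atBot (q i)).comp (tendsto_atBot_add_const_right _ (-c i) tendsto_id)
    simpa using tendsto_tsum_of_dominated_convergence (hgeo.summable.mul_left (1 / 4)) h0
      (.of_forall fun x i => hbd i (x - c i))
  · intro i
    refine ⟨a i, c i, δ i, ha i, fun s hs => ?_⟩
    beta_reduce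
    rw [(hsum _).tsum_eq_add_tsum_ite i]
    have h1 : |∑' j, ite (j = i) 0 (gaussTerm (q j) (c i + δ i * s - c j))| ≤
        2 * (a i * e i / 4) := by
      rw [← Real.norm_eq_abs]
      refine tsum_of_norm_bounded (hgeo.mul_right _) fun j => ?_
      split_ifs with hj
      · have := ha i; have := he i
        rw [norm_zero]; positivity
      · have := hcross i j (Ne.symm hj) (δ i * s) (by
          rw [abs_mul, abs_of_pos (hδ i)]
          exact mul_le_one₀ (hδ1 i) (abs_nonneg _) (abs_le.mpr hs))
        rwa [add_comm (c i)]
    have h2 := happ i s hs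
    rw [add_sub_cancel_left]
    rw [abs_le] at h1 h2 ⊢
    constructor <;> linarith [h1.1, h1.2, h2.1, h2.2]

lemma exists_dense_polynomials : ∃ p : ℕ → ℝ[X], ∀ g : ℝ → ℝ, Continuous g → ∀ ε, 0 < ε →
    ∃ i, ∀ s ∈ Set.Icc (-1 : ℝ) 1, |(p i).eval s - g s| ≤ ε := by
  let V := polynomialFunctions (Set.Icc (-1 : ℝ) 1)
  have hV : ∀ i, ∃ p : ℝ[X], p.toContinuousMapOn (Set.Icc (-1 : ℝ) 1) =
      (TopologicalSpace.denseSeq V i : C(Set.Icc (-1 : ℝ) 1, ℝ)) := by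
    intro i
    obtain ⟨p, -, hp⟩ := (TopologicalSpace.denseSeq V i).2
    exact ⟨p, hp⟩
  choose p hp using hV
  refine ⟨p, fun g hg ε hε => ?_⟩
  let G : C(Set.Icc (-1 : ℝ) 1, ℝ) := ⟨fun s => g s, by fun_prop⟩
  obtain ⟨P, hP⟩ := exists_polynomial_near_continuousMap (-1) 1 G (ε / 2) (half_pos hε)
  obtain ⟨i, hi⟩ := (TopologicalSpace.denseRange_denseSeq V).exists_dist_lt
    ⟨P.toContinuousMapOn _, P, trivial, rfl⟩ (half_pos hε)
  refine ⟨i, fun s hs => ?_⟩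
  rw [dist_comm, Subtype.dist_eq, ← hp, dist_eq_norm] at hi
  have h1 := (ContinuousMap.norm_coe_le_norm _ (⟨s, hs⟩ : Set.Icc (-1 : ℝ) 1)).trans hi.le
  have h2 := (ContinuousMap.norm_coe_le_norm _ (⟨s, hs⟩ : Set.Icc (-1 : ℝ) 1)).trans hP.le
  simp only [ContinuousMap.sub_apply, Polynomial.toContinuousMapOn_apply,
    Polynomial.toContinuousMap_apply, Real.norm_eq_abs, G, ContinuousMap.coe_mk] at h1 h2
  have e1 : (p i).eval s - g s = ((p i).eval s - P.eval s) + (P.eval s - g s) := by ring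
  rw [e1]
  exact (abs_add_le _ _).trans (by linarith)

lemma exists_analytic_universal :
    ∃ T : ℝ → ℝ, AnalyticOnNhd ℝ T Set.univ ∧ (∀ x y, |T x - T y| ≤ 1 / 2 * |x - y|) ∧
      Tendsto T atBot (𝓝 0) ∧ ∀ g : ℝ → ℝ, Continuous g → ∀ ε, 0 < ε → ∃ a c δ : ℝ, 0 < a ∧
        ∀ s ∈ Set.Icc (-1 : ℝ) 1, |T (c + δ * s) - a * g s| ≤ a * ε := by
  obtain ⟨p, hp⟩ := exists_dense_polynomials
  obtain ⟨T, hT, hlip, hlim, happ⟩ := exists_analytic_reproducing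
    (fun m => p m.unpair.1) (e := fun m => 1 / ((m.unpair.2 : ℝ) + 1)) fun i => by positivity
  refine ⟨T, hT, hlip, hlim, fun g hg ε hε => ?_⟩
  obtain ⟨i, hi⟩ := hp g hg (ε / 2) (half_pos hε)
  obtain ⟨k, hk⟩ := exists_nat_one_div_lt (half_pos hε)
  obtain ⟨a, c, δ, ha, h⟩ := happ (Nat.pair i k)
  refine ⟨a, c, δ, ha, fun s hs => ?_⟩
  have h1 := h s hs
  simp only [Nat.unpair_pair] at h1
  have h2 : |a * (p i).eval s - a * g s| ≤ a * (ε / 2) := by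
    rw [← mul_sub, abs_mul, abs_of_pos ha]
    gcongr
    exact hi s hs
  have h3 : a * (1 / ((k : ℝ) + 1)) ≤ a * (ε / 2) := by gcongr
  rw [abs_le] at h1 h2 ⊢
  constructor <;> linarith [h1.1, h1.2, h2.1, h2.2]

/-- The activation function: every continuous function on a bounded interval is approximated by a
combination of three of its affine reparametrizations. -/
lemma exists_activation :
    ∃ σ : ℝ → ℝ, AnalyticOnNhd ℝ σ Set.univ ∧ StrictMono σ ∧
      ∀ g : ℝ → ℝ, Continuous g → ∀ L, 0 < L → ∀ ε, 0 < ε → ∃ d l γ : Fin 3 → ℝ,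
        ∀ t, |t| ≤ L → |∑ k, d k * σ (l k * t - γ k) - g t| ≤ ε := by
  obtain ⟨T, hT, hlip, hlim, happ⟩ := exists_analytic_universal
  have hmono : StrictMono fun x => x + T x := by
    intro x y hxy
    have h := (abs_le.mp (hlip y x)).1
    rw [abs_of_pos (sub_pos.mpr hxy)] at h
    simp only
    linarith
  refine ⟨fun x => x + T x, analyticOnNhd_id.add hT, hmono, fun g hg L hL ε hε => ?_⟩
  obtain ⟨θ, hθ⟩ : ∃ θ : ℝ, θ + T θ ≠ 0 := by
    by_contra! h
    have := hmono zero_lt_one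
    simp only [h] at this
    exact lt_irrefl _ this
  obtain ⟨a, c, δ, ha, h⟩ := happ (fun s => g (L * s)) (by fun_prop) (ε / 2) (half_pos hε)
  obtain ⟨b, hb⟩ := eventually_atBot.mp (hlim.eventually
    (Metric.closedBall_mem_nhds 0 (by positivity : 0 < a * (ε / 2))))
  refine ⟨![1 / a, -(1 / a), -((c + (|δ| - b)) / (a * (θ + T θ)))], ![δ / L, δ / L, 0],
    ![-c, |δ| - b, -θ], fun t ht => ?_⟩
  have hs : t / L ∈ Set.Icc (-1 : ℝ) 1 := by
    refine abs_le.mp ?_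
    rwa [abs_div, abs_of_pos hL, div_le_one hL]
  have h1 := h _ hs
  have h2 : |T (δ * (t / L) - (|δ| - b))| ≤ a * (ε / 2) := by
    have : δ * (t / L) - (|δ| - b) ≤ b := by
      have h3 : |δ * (t / L)| ≤ |δ| := by
        rw [abs_mul]
        exact mul_le_of_le_one_right (abs_nonneg _) (abs_le.mpr hs)
      linarith [le_abs_self (δ * (t / L))]
    simpa using hb _ this
  simp only [mul_div_cancel₀ t hL.ne'] at h1
  simp only [Fin.sum_univ_three, Matrix.cons_val_zero, Matrix.cons_val_one, Matrix.cons_val]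
  have e1 : δ / L * t = δ * (t / L) := by ring
  rw [e1, sub_neg_eq_add, add_comm _ c, zero_mul, zero_sub, neg_neg]
  have e2 : 1 / a * (c + δ * (t / L) + T (c + δ * (t / L))) +
      -(1 / a) * (δ * (t / L) - (|δ| - b) + T (δ * (t / L) - (|δ| - b))) +
      -((c + (|δ| - b)) / (a * (θ + T θ))) * (θ + T θ) - g t =
      (T (c + δ * (t / L)) - a * g t - T (δ * (t / L) - (|δ| - b))) / a := by
    field_simp
    ring
  rw [e2, abs_div, abs_of_pos ha, div_le_iff₀ ha]
  exact (abs_sub _ _).trans (by linarith)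

/-- A continuous staircase: it climbs from `k - 1` to `k` on `[k * M, k * M + 1]` for
`1 ≤ k ≤ K` and is constant in between. -/
noncomputable def staircase (M K : ℕ) (y : ℝ) : ℝ :=
  ∑ a ∈ Finset.range K, max 0 (min 1 (y - (a + 1) * M))

lemma continuous_staircase (M K : ℕ) : Continuous (staircase M K) := by
  unfold staircase; fun_prop

lemma sum_range_ite_lt {k K : ℕ} (hk : k ≤ K) :
    ∑ a ∈ Finset.range K, (if a < k then (1 : ℝ) else 0) = k := by
  rw [← Finset.sum_filter, Finset.sum_const]
  have : Finset.filter (fun a => a < k) (Finset.range K) = Finset.range k := by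
    ext a; simp; omega
  simp [this]

lemma staircase_le {M K k : ℕ} (hk : k ≤ K) {y : ℝ} (h : y ≤ (k + 1) * M) :
    staircase M K y ≤ k := by
  rw [← sum_range_ite_lt hk]
  refine Finset.sum_le_sum fun a _ => ?_
  split_ifs with hak
  · exact max_le zero_le_one (min_le_left _ _)
  · have : (k : ℝ) ≤ a := by exact_mod_cast not_lt.mp hak
    refine max_le le_rfl (min_le_of_right_le ?_)
    nlinarith [Nat.cast_nonneg (α := ℝ) M]

lemma le_staircase {M K k : ℕ} (hk : k ≤ K) {y : ℝ} (h : (k : ℝ) * M + 1 ≤ y) :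
    (k : ℝ) ≤ staircase M K y := by
  rw [← sum_range_ite_lt hk]
  refine Finset.sum_le_sum fun a _ => ?_
  split_ifs with hak
  · have : (a : ℝ) + 1 ≤ k := by exact_mod_cast hak
    refine le_max_of_le_right (le_min le_rfl ?_)
    nlinarith [Nat.cast_nonneg (α := ℝ) M]
  · exact le_max_left _ _

lemma staircase_nonneg (M K : ℕ) (y : ℝ) : 0 ≤ staircase M K y :=
  Finset.sum_nonneg fun _ _ => le_max_left _ _

lemma staircase_le_card (M K : ℕ) (y : ℝ) : staircase M K y ≤ K := by
  refine (Finset.sum_le_card_nsmul _ _ 1 fun a _ => max_le zero_le_one (min_le_left _ _)).trans ?_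
  simp

lemma abs_mul_staircase_sub_le {M K : ℕ} (hM : 1 ≤ M) {y : ℝ} (hy : 0 ≤ y)
    (hyK : y ≤ K * M) : |M * staircase M K y - y| ≤ 2 * M := by
  have hM' : (1 : ℝ) ≤ M := by exact_mod_cast hM
  have hM0 : (0 : ℝ) < M := by linarith
  set k := ⌊y / M⌋₊ with hk
  have h1 : (k : ℝ) * M ≤ y := by
    have := Nat.floor_le (div_nonneg hy hM0.le)
    rwa [le_div_iff₀ hM0] at this
  have h2 : y < (k + 1) * M := by
    have := Nat.lt_floor_add_one (y / M)
    rwa [div_lt_iff₀ hM0] at this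
  have hkK : k ≤ K := by
    have : (k : ℝ) ≤ K := by
      by_contra! h
      nlinarith
    exact_mod_cast this
  have hu := staircase_le hkK h2.le
  have hl : (k : ℝ) - 1 ≤ staircase M K y := by
    rcases Nat.eq_zero_or_pos k with h0 | h0
    · rw [h0]; have := staircase_nonneg M K y; push_cast; linarith
    · have := le_staircase (M := M) (K := K) (k := k - 1) (y := y) (by omega) (by
        rw [Nat.cast_sub h0]; push_cast; nlinarith)
      rwa [Nat.cast_sub h0, Nat.cast_one] at this
  rw [abs_le]
  constructor <;> nlinarith

lemma exists_injective_add_mul {ι X : Type*} [Finite ι] [Finite X] (A : ι → X → ℝ) {c : X → ℝ}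
    (hc : Function.Injective c) {τ₀ : ℝ} (hτ₀ : 0 < τ₀) :
    ∃ τ, 0 < τ ∧ τ < τ₀ ∧ ∀ i, Function.Injective fun k => A i k + τ * c k := by
  have hfin : (Set.range fun p : ι × X × X =>
      (A p.1 p.2.2 - A p.1 p.2.1) / (c p.2.1 - c p.2.2)).Finite := Set.finite_range _
  obtain ⟨τ, hτ, hbad⟩ := ((Set.Ioo_infinite hτ₀).sdiff hfin).nonempty
  refine ⟨τ, hτ.1, hτ.2, fun i k k' h => ?_⟩
  by_contra hne
  refine hbad ⟨(i, k, k'), ?_⟩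
  have : c k - c k' ≠ 0 := sub_ne_zero.mpr (hc.ne hne)
  simp only at h ⊢
  rw [div_eq_iff this]
  linarith

/-- The point `t` moved into the unit interval. -/
noncomputable def clampUnit (t : ℝ) : ℝ := max 0 (min 1 t)

lemma clampUnit_mem (t : ℝ) : clampUnit t ∈ Set.Icc (0 : ℝ) 1 :=
  ⟨le_max_left _ _, max_le zero_le_one (min_le_left _ _)⟩

lemma continuous_clampUnit : Continuous clampUnit := by
  unfold clampUnit; fun_prop

lemma clampUnit_of_mem {t : ℝ} (ht : t ∈ Set.Icc (0 : ℝ) 1) : clampUnit t = t := by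
  simp [clampUnit, ht.1, ht.2]

lemma abs_clampUnit_sub_le (s : ℝ) {t : ℝ} (ht : t ∈ Set.Icc (0 : ℝ) 1) :
    |clampUnit s - t| ≤ |s - t| := by
  obtain ⟨h0, h1⟩ := ht
  unfold clampUnit
  rcases le_total s 0 with h | h
  · rw [min_eq_right (by linarith), max_eq_left h, abs_of_nonpos (by linarith),
      abs_of_nonpos (by linarith)]
    linarith
  · rcases le_total s 1 with h' | h'
    · rw [min_eq_right h', max_eq_right h]
    · rw [min_eq_left h', max_eq_right zero_le_one, abs_of_nonneg (by linarith),
        abs_of_nonneg (by linarith)]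
      linarith

/-- Among `M` shifted grids of period `M`, at most `n` have a gap at one of `n` given positions. -/
lemma card_bad_le {n M : ℕ} (l : Fin n → ℕ) :
    (Finset.univ.filter fun i : Fin M => ∃ j, (l j + i) % M = 0).card ≤ n := by
  have hsub : (Finset.univ.filter fun i : Fin M => ∃ j, (l j + i) % M = 0) =
      Finset.univ.biUnion fun j : Fin n =>
        Finset.univ.filter fun i : Fin M => (l j + i) % M = 0 := by
    ext i; simp
  rw [hsub]
  refine (Finset.card_biUnion_le_card_mul _ _ 1 fun j _ => ?_).trans (by simp)
  rw [Finset.card_le_one]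
  intro i hi i' hi'
  simp only [Finset.mem_filter, Finset.mem_univ, true_and] at hi hi'
  have h : (i : ℕ) ≡ i' [MOD M] :=
    Nat.ModEq.add_left_cancel' (l j) (hi.trans hi'.symm)
  exact Fin.ext (by rwa [Nat.ModEq, Nat.mod_eq_of_lt i.2, Nat.mod_eq_of_lt i'.2] at h)

lemma abs_sub_sum_le {n M : ℕ} (hM : M = 2 * n + 1) (v : Fin M → ℝ) {s : Finset (Fin M)}
    (hs : s.card ≤ n) {r R η : ℝ} (hr : |r| ≤ R) (hη : 0 ≤ η)
    (hgood : ∀ i ∉ s, |r / (n + 1) - v i| ≤ η / 2 / (n + 1))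
    (hbad : ∀ i ∈ s, |v i| ≤ R / (n + 1)) :
    |r - ∑ i, v i| ≤ n / (n + 1) * R + η := by
  subst hM
  have hn : (0 : ℝ) < n + 1 := by positivity
  have hcard : (sᶜ.card : ℝ) = 2 * n + 1 - s.card := by
    rw [Finset.card_compl, Nat.cast_sub (by simpa using by omega)]; simp
  have hsn : (s.card : ℝ) ≤ n := by exact_mod_cast hs
  have e : r - ∑ i, v i = - (r * ((n - s.card) / (n + 1))) + ∑ i ∈ sᶜ, (r / (n + 1) - v i)
      - ∑ i ∈ s, v i := by
    rw [Finset.sum_sub_distrib, Finset.sum_const, nsmul_eq_mul, hcard,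
      ← Finset.sum_add_sum_compl s]
    field_simp
    ring
  have h1 : |r * ((n - s.card) / (n + 1))| ≤ R * ((n - s.card) / (n + 1)) := by
    have : (0 : ℝ) ≤ (n - s.card) / (n + 1) := div_nonneg (by linarith) hn.le
    rw [abs_mul, abs_of_nonneg this]
    gcongr
  have h2 : |∑ i ∈ sᶜ, (r / (n + 1) - v i)| ≤ (2 * n + 1 - s.card) * (η / 2 / (n + 1)) := by
    refine (Finset.abs_sum_le_sum_abs _ _).trans ?_
    rw [← hcard, ← nsmul_eq_mul]
    exact Finset.sum_le_card_nsmul _ _ _ fun i hi => hgood i (by simpa using hi)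
  have h3 : |∑ i ∈ s, v i| ≤ s.card * (R / (n + 1)) := by
    refine (Finset.abs_sum_le_sum_abs _ _).trans ?_
    rw [← nsmul_eq_mul]
    exact Finset.sum_le_card_nsmul _ _ _ fun i hi => hbad i hi
  have h4 : (2 * n + 1 - s.card) * (η / 2 / (n + 1)) ≤ η := by
    have : η / 2 / (n + 1) * (2 * (n + 1)) = η := by field_simp
    have h0 : 0 ≤ η / 2 / (n + 1) := by positivity
    nlinarith [Nat.cast_nonneg (α := ℝ) s.card]
  have h5 : R * ((n - s.card) / (n + 1)) + s.card * (R / (n + 1)) = n / (n + 1) * R := by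
    field_simp; ring
  rw [e]
  have := abs_sub (-(r * ((n - s.card) / (n + 1))) + ∑ i ∈ sᶜ, (r / (n + 1) - v i)) (∑ i ∈ s, v i)
  have h6 := abs_add_le (-(r * ((n - s.card) / (n + 1)))) (∑ i ∈ sᶜ, (r / (n + 1) - v i))
  rw [abs_neg] at h6
  linarith

lemma exists_perturbation_reducing {n M : ℕ} (hM : M = 2 * n + 1) {φ : Fin M → Fin n → ℝ → ℝ}
    (hφ : ∀ i j, Continuous (φ i j)) {r : (Fin n → ℝ) → ℝ} (hr : Continuous r) {R : ℝ}
    (hR : ∀ x ∈ Set.Icc (0 : Fin n → ℝ) 1, |r x| ≤ R) {η : ℝ} (hη : 0 < η) :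
    ∃ (ψ : Fin M → Fin n → ℝ → ℝ) (g : Fin M → ℝ → ℝ),
      (∀ i j, Continuous (ψ i j)) ∧ (∀ i, Continuous (g i)) ∧
      (∀ i j, ∀ t ∈ Set.Icc (0 : ℝ) 1, |ψ i j t - φ i j t| ≤ η) ∧
      ∀ x ∈ Set.Icc (0 : Fin n → ℝ) 1,
        |r x - ∑ i, g i (∑ j, ψ i j (x j))| ≤ n / (n + 1) * R + η := by
  have hR0 : 0 ≤ R := (abs_nonneg _).trans (hR 0 ⟨le_rfl, fun _ => zero_le_one⟩)
  have hn : (0 : ℝ) < n + 1 := by positivity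
  obtain ⟨δ₁, hδ₁, hu₁⟩ := Metric.uniformContinuousOn_iff.mp
    ((isCompact_Icc (a := (0 : ℝ)) (b := 1)).uniformContinuousOn_of_continuous
      (f := fun t i j => φ i j t) (by fun_prop)) (η / 2) (by positivity)
  obtain ⟨δ₂, hδ₂, hu₂⟩ := Metric.uniformContinuousOn_iff.mp
    ((isCompact_Icc (a := (0 : Fin n → ℝ)) (b := 1)).uniformContinuousOn_of_continuous
      hr.continuousOn) (η / 2) (by positivity)
  have hM0 : (0 : ℝ) < M := by rw [hM]; positivity
  have hM1 : (1 : ℝ) ≤ M := by exact_mod_cast (by omega : 1 ≤ M)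
  obtain ⟨N, hN⟩ := exists_nat_gt (2 * M / min δ₁ δ₂)
  have hδ : 0 < min δ₁ δ₂ := lt_min hδ₁ hδ₂
  have hN0 : (0 : ℝ) < N := lt_of_le_of_lt (by positivity) hN
  have hNδ : 2 * M / N < min δ₁ δ₂ := by
    rw [div_lt_iff₀ hδ] at hN
    rw [div_lt_iff₀ hN0]; linarith
  set K := N + M with hK
  set B := K + 1 with hB
  let S := staircase M K
  let p : Fin M → ℝ → ℝ := fun i s => clampUnit ((M * s - (i : ℕ)) / N)
  have hp : ∀ (i : Fin M), ∀ t ∈ Set.Icc (0 : ℝ) 1, |p i (S (N * t + (i : ℕ))) - t| ≤ 2 * M / N := by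
    intro i t ht
    refine (abs_clampUnit_sub_le _ ht).trans ?_
    have hi : ((i : ℕ) : ℝ) ≤ M := by exact_mod_cast i.2.le
    have hb : |M * S (N * t + (i : ℕ)) - (N * t + (i : ℕ))| ≤ 2 * M := by
      refine abs_mul_staircase_sub_le (by omega) ?_ ?_
      · have := ht.1; positivity
      · rw [hK]; push_cast
        have : (N : ℝ) * t ≤ N := by nlinarith [ht.2]
        nlinarith
    have : (M * S (N * t + (i : ℕ)) - (i : ℕ)) / N - t =
        (M * S (N * t + (i : ℕ)) - (N * t + (i : ℕ))) / N := by
      field_simp; ring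
    rw [this, abs_div, abs_of_pos hN0]
    gcongr
  have hcode : Function.Injective
      fun k : Fin n → Fin B => (∑ j, ((k j : ℕ) : ℝ) * (B : ℝ) ^ (j : ℕ)) := by
    intro k k' h
    apply finFunctionFinEquiv.injective
    apply Fin.ext
    rw [finFunctionFinEquiv_apply, finFunctionFinEquiv_apply]
    beta_reduce at h
    exact_mod_cast h
  obtain ⟨τ, hτ0, hτ1, hinj⟩ := exists_injective_add_mul
    (fun (i : Fin M) (k : Fin n → Fin B) => ∑ j, φ i j (p i (k j : ℕ))) hcode
    (τ₀ := η / 2 / B ^ n) (by positivity)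
  have hext : ∀ i : Fin M, ∃ g : C(ℝ, ℝ), (∀ y, g y ∈ Set.Icc (-(R / (n + 1))) (R / (n + 1))) ∧
      ∀ k : Fin n → Fin B, g (∑ j, φ i j (p i (k j : ℕ)) +
        τ * ∑ j, ((k j : ℕ) : ℝ) * (B : ℝ) ^ (j : ℕ)) =
        r (fun j => p i (k j : ℕ)) / (n + 1) := by
    intro i
    obtain ⟨g, hg, hge⟩ := ContinuousMap.exists_extension_forall_mem_of_isClosedEmbedding
      (X := Fin n → Fin B) (t := Set.Icc (-(R / (n + 1))) (R / (n + 1)))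
      ⟨fun k => r (fun j => p i (k j : ℕ)) / (n + 1), continuous_of_discreteTopology⟩
      (fun k => by
        have := hR (fun j => p i (k j : ℕ))
          ⟨fun j => (clampUnit_mem _).1, fun j => (clampUnit_mem _).2⟩
        have h : |r (fun j => p i (k j : ℕ)) / (n + 1)| ≤ R / (n + 1) := by
          rw [abs_div, abs_of_pos hn]
          gcongr
        exact abs_le.mp h)
      ⟨0, neg_nonpos.mpr (by positivity), by positivity⟩
      (Continuous.isClosedEmbedding continuous_of_discreteTopology (hinj i))
    exact ⟨g, hg, fun k => congrFun hge k⟩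
  choose g hg hgv using hext
  refine ⟨fun i j t => φ i j (p i (S (N * t + (i : ℕ)))) +
    τ * (S (N * t + (i : ℕ)) * (B : ℝ) ^ (j : ℕ)), fun i => g i, ?_, fun i => (g i).continuous,
    ?_, ?_⟩
  · intro i j
    have hS : Continuous S := continuous_staircase M K
    have hc := continuous_clampUnit
    have := hφ i j
    fun_prop
  · intro i j t ht
    have h1 : |φ i j (p i (S (N * t + (i : ℕ)))) - φ i j t| ≤ η / 2 := by
      have := hu₁ _ (clampUnit_mem _) t ht
        (lt_of_le_of_lt (hp i t ht) (hNδ.trans_le (min_le_left _ _)))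
      have h' := (dist_le_pi_dist _ _ j).trans ((dist_le_pi_dist _ _ i).trans this.le)
      exact h'
    have h2 : |τ * (S (N * t + (i : ℕ)) * (B : ℝ) ^ (j : ℕ))| ≤ η / 2 := by
      have hS0 : 0 ≤ S (N * t + (i : ℕ)) := staircase_nonneg _ _ _
      have hS1 : S (N * t + (i : ℕ)) ≤ B := (staircase_le_card _ _ _).trans (by
        rw [hB]; push_cast; linarith)
      rw [abs_of_nonneg (by positivity)]
      have hB1 : (1 : ℝ) ≤ B := by rw [hB]; push_cast; linarith [Nat.cast_nonneg (α := ℝ) K]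
      calc τ * (S (N * t + (i : ℕ)) * (B : ℝ) ^ (j : ℕ))
          ≤ (η / 2 / B ^ n) * (B * (B : ℝ) ^ (j : ℕ)) := by gcongr
        _ = (η / 2 / B ^ n) * (B : ℝ) ^ ((j : ℕ) + 1) := by ring
        _ ≤ (η / 2 / B ^ n) * (B : ℝ) ^ n := by
            gcongr
            exact j.2
        _ = η / 2 := by field_simp
    have e : φ i j (p i (S (N * t + (i : ℕ)))) + τ * (S (N * t + (i : ℕ)) * (B : ℝ) ^ (j : ℕ)) -
      φ i j t = (φ i j (p i (S (N * t + (i : ℕ)))) - φ i j t) +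
        τ * (S (N * t + (i : ℕ)) * (B : ℝ) ^ (j : ℕ)) := by ring
    beta_reduce
    rw [e]
    exact (abs_add_le _ _).trans (by linarith)
  · intro x hx
    have hxj : ∀ j, x j ∈ Set.Icc (0 : ℝ) 1 := fun j => ⟨hx.1 j, hx.2 j⟩
    refine abs_sub_sum_le hM _ (card_bad_le fun j => ⌊N * x j⌋₊) (hR x hx) hη.le ?_ ?_
    · intro i hi
      simp only [Finset.mem_filter, Finset.mem_univ, true_and, not_exists] at hi
      let k : Fin n → ℕ := fun j => (⌊N * x j⌋₊ + i) / M
      have hkK : ∀ j, k j ≤ K := by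
        intro j
        have h1 : ⌊N * x j⌋₊ ≤ N := by
          refine Nat.floor_le_of_le ?_
          nlinarith [(hxj j).2]
        have := i.2
        exact (Nat.div_le_self _ _).trans (by omega)
      have hS : ∀ j, S (N * x j + (i : ℕ)) = k j := by
        intro j
        have hnn : 0 ≤ N * x j := mul_nonneg hN0.le (hxj j).1
        have hl := Nat.floor_le hnn
        have hr := Nat.lt_floor_add_one (N * x j)
        have hdm : M * k j + (⌊N * x j⌋₊ + i) % M = ⌊N * x j⌋₊ + i := Nat.div_add_mod _ _
        have hm := Nat.mod_lt (⌊N * x j⌋₊ + i) (by omega : 0 < M)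
        have hm0 := hi j
        have h1 : k j * M + 1 ≤ ⌊N * x j⌋₊ + (i : ℕ) := by
          rw [mul_comm (k j)]; omega
        have h2 : ⌊N * x j⌋₊ + (i : ℕ) + 1 ≤ (k j + 1) * M := by
          rw [add_mul, mul_comm (k j)]; omega
        have h1' : (k j : ℝ) * M + 1 ≤ ⌊N * x j⌋₊ + (i : ℕ) := by exact_mod_cast h1
        have h2' : (⌊N * x j⌋₊ : ℝ) + (i : ℕ) + 1 ≤ (k j + 1) * M := by exact_mod_cast h2
        exact le_antisymm (staircase_le (hkK j) (by linarith))
          (le_staircase (hkK j) (by linarith))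
      have hv := hgv i fun j => ⟨k j, Nat.lt_succ_of_le (hkK j)⟩
      simp only [Finset.mul_sum, ← Finset.sum_add_distrib, ← hS] at hv
      beta_reduce
      rw [hv, ← sub_div, abs_div, abs_of_pos hn]
      gcongr
      refine (hu₂ x hx _ ⟨fun j => (clampUnit_mem _).1, fun j => (clampUnit_mem _).2⟩ ?_).le
      rw [dist_pi_lt_iff hδ₂]
      intro j
      rw [dist_comm]
      exact lt_of_le_of_lt (hp i _ (hxj j)) (hNδ.trans_le (min_le_right _ _))
    · intro i _
      exact abs_le.mpr (hg i _)

lemma exists_modulus {ι : Type*} [Fintype ι] {g : ι → ℝ → ℝ} (hg : ∀ i, Continuous (g i))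
    {C : Set ℝ} (hC : IsCompact C) {ε : ℝ} (hε : 0 < ε) :
    ∃ δ, 0 < δ ∧ ∀ i, ∀ y ∈ C, ∀ y', |y' - y| ≤ δ → |g i y' - g i y| ≤ ε := by
  have hG : Continuous fun (y : ℝ) i => g i y := by fun_prop
  have h := hC.uniformContinuousAt_of_continuousAt _ (fun a _ => hG.continuousAt)
    (Metric.dist_mem_uniformity hε)
  obtain ⟨δ, hδ, h⟩ := Metric.mem_uniformity_dist.mp h
  refine ⟨δ / 2, by positivity, fun i y hy y' hyy' => ?_⟩
  have hd : dist y y' < δ := by rw [dist_comm, Real.dist_eq]; linarith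
  have h1 := (dist_le_pi_dist _ _ i).trans (le_of_lt (h hd hy))
  rwa [dist_comm, Real.dist_eq] at h1

lemma abs_sum_sub_sum_le {ι : Type*} [Fintype ι] {a b : ι → ℝ} {η : ℝ}
    (h : ∀ i, |a i - b i| ≤ η) : |∑ i, a i - ∑ i, b i| ≤ Fintype.card ι * η := by
  rw [← Finset.sum_sub_distrib, ← nsmul_eq_mul]
  exact (Finset.abs_sum_le_sum_abs _ _).trans (Finset.sum_le_card_nsmul _ _ _ fun i _ => h i)

lemma exists_superposition_pow {n M : ℕ} (hM : M = 2 * n + 1) {u : (Fin n → ℝ) → ℝ}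
    (hu : Continuous u) {R : ℝ} (hR0 : 0 < R) (hR : ∀ x ∈ Set.Icc (0 : Fin n → ℝ) 1, |u x| ≤ R)
    (K : ℕ) :
    ∃ (φ : Fin M → Fin n → ℝ → ℝ) (g : Fin M → ℝ → ℝ),
      (∀ i j, Continuous (φ i j)) ∧ (∀ i, Continuous (g i)) ∧
      ∀ x ∈ Set.Icc (0 : Fin n → ℝ) 1,
        |u x - ∑ i, g i (∑ j, φ i j (x j))| ≤ ((2 * n + 1) / (2 * n + 2)) ^ K * R := by
  induction K with
  | zero => exact ⟨fun _ _ _ => 0, fun _ _ => 0, fun _ _ => continuous_const,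
      fun _ => continuous_const, by simpa using hR⟩
  | succ K ih =>
    obtain ⟨φ, g, hφ, hg, h⟩ := ih
    set Q := ((2 * n + 1) / (2 * n + 2) : ℝ) ^ K * R with hQ
    have hQ0 : 0 < Q := by positivity
    set s := Q / (2 * n + 2) with hs
    have hs0 : 0 < s := by positivity
    have hM0 : (0 : ℝ) < M := by rw [hM]; positivity
    obtain ⟨δ, hδ, hmod⟩ := exists_modulus hg
      (isCompact_iUnion fun i => (isCompact_Icc (a := (0 : Fin n → ℝ)) (b := 1)).image
        (f := fun x => ∑ j, φ i j (x j)) (by fun_prop))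
      (ε := s / 2 / M) (by positivity)
    obtain ⟨ψ, g', hψ, hg', hclose, hres⟩ := exists_perturbation_reducing hM hφ
      (r := fun x => u x - ∑ i, g i (∑ j, φ i j (x j))) (by fun_prop) h
      (η := min (s / 2) (δ / (n + 1))) (by positivity)
    refine ⟨ψ, fun i y => g i y + g' i y, hψ, fun i => (hg i).add (hg' i), fun x hx => ?_⟩
    have h1 : |∑ i, g i (∑ j, ψ i j (x j)) - ∑ i, g i (∑ j, φ i j (x j))| ≤ s / 2 := by
      refine (abs_sum_sub_sum_le fun i => hmod i _
        (Set.mem_iUnion.mpr ⟨i, x, hx, rfl⟩) _ ?_).trans ?_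
      · refine (abs_sum_sub_sum_le fun j => (hclose i j _ ⟨hx.1 j, hx.2 j⟩).trans
          (min_le_right _ _)).trans ?_
        rw [Fintype.card_fin, mul_div_assoc', div_le_iff₀ (by positivity)]
        nlinarith
      · rw [Fintype.card_fin]
        exact (mul_div_cancel₀ _ hM0.ne').le
    have h2 := hres x hx
    have h3 := min_le_left (s / 2) (δ / (n + 1))
    have h4 : n / (n + 1) * Q + s = ((2 * n + 1) / (2 * n + 2) : ℝ) ^ (K + 1) * R := by
      rw [pow_succ, mul_right_comm, ← hQ, hs]
      field_simp
    rw [← h4]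
    simp only [Finset.sum_add_distrib]
    rw [abs_le] at h1 h2 ⊢
    constructor <;> linarith [h1.1, h1.2, h2.1, h2.2]

/-- An approximate form of the Kolmogorov superposition theorem. -/
lemma exists_superposition {n M : ℕ} (hM : M = 2 * n + 1) {u : (Fin n → ℝ) → ℝ}
    (hu : Continuous u) {ε : ℝ} (hε : 0 < ε) :
    ∃ (φ : Fin M → Fin n → ℝ → ℝ) (g : Fin M → ℝ → ℝ),
      (∀ i j, Continuous (φ i j)) ∧ (∀ i, Continuous (g i)) ∧
      ∀ x ∈ Set.Icc (0 : Fin n → ℝ) 1, |u x - ∑ i, g i (∑ j, φ i j (x j))| ≤ ε := by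
  obtain ⟨R, hR⟩ := (isCompact_Icc (a := (0 : Fin n → ℝ)) (b := 1)).exists_bound_of_continuousOn
    hu.continuousOn
  have hR0 : 0 < max R 1 := by positivity
  obtain ⟨K, hK⟩ := exists_pow_lt_of_lt_one (div_pos hε hR0)
    (y := ((2 * n + 1) / (2 * n + 2) : ℝ)) (by rw [div_lt_one (by positivity)]; linarith)
  obtain ⟨φ, g, hφ, hg, h⟩ := exists_superposition_pow hM hu hR0
    (fun x hx => (hR x hx).trans (le_max_left _ _)) K
  refine ⟨φ, g, hφ, hg, fun x hx => (h x hx).trans ?_⟩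
  rw [lt_div_iff₀ hR0] at hK
  exact hK.le

lemma exists_network {σ : ℝ → ℝ} (hσ : ∀ g : ℝ → ℝ, Continuous g → ∀ L, 0 < L → ∀ ε, 0 < ε →
      ∃ d l γ : Fin 3 → ℝ, ∀ t, |t| ≤ L → |∑ k, d k * σ (l k * t - γ k) - g t| ≤ ε)
    {n M : ℕ} (hM : M = 2 * n + 1) {u : (Fin n → ℝ) → ℝ} (hu : Continuous u) {ε : ℝ}
    (hε : 0 < ε) :
    ∃ (d l γ : Fin M → Fin 3 → ℝ) (d' l' γ' : Fin M → Fin n → Fin 3 → ℝ),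
      ∀ x ∈ Set.Icc (0 : Fin n → ℝ) 1,
        |u x - ∑ i, ∑ k, d i k * σ (l i k *
          (∑ j, ∑ k', d' i j k' * σ (l' i j k' * x j - γ' i j k')) - γ i k)| < ε := by
  obtain ⟨φ, g, hφ, hg, happ⟩ := exists_superposition hM hu (ε := ε / 4) (by positivity)
  have hM0 : (0 : ℝ) < M := by rw [hM]; positivity
  have hC := isCompact_iUnion fun i => (isCompact_Icc (a := (0 : Fin n → ℝ)) (b := 1)).image
    (f := fun x => ∑ j, φ i j (x j)) (by fun_prop)
  obtain ⟨δ, hδ, hmod⟩ := exists_modulus hg hC (ε := ε / 4 / M) (by positivity)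
  obtain ⟨L, hL⟩ := hC.exists_bound_of_continuousOn continuous_id.continuousOn
  choose d l γ hout using fun i => hσ (g i) (hg i) (|L| + 1) (by positivity) (ε / 4 / M)
    (by positivity)
  choose d' l' γ' hin using fun i j => hσ (φ i j) (hφ i j) 1 one_pos (min δ 1 / (n + 1))
    (by positivity)
  refine ⟨d, l, γ, d', l', γ', fun x hx => ?_⟩
  set y : Fin M → ℝ := fun i => ∑ j, φ i j (x j) with hy
  set y' : Fin M → ℝ := fun i => ∑ j, ∑ k', d' i j k' * σ (l' i j k' * x j - γ' i j k') with hy'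
  have hyC : ∀ i, y i ∈ ⋃ i, (fun x => ∑ j, φ i j (x j)) '' Set.Icc (0 : Fin n → ℝ) 1 :=
    fun i => Set.mem_iUnion.mpr ⟨i, x, hx, rfl⟩
  have hyy : ∀ i, |y' i - y i| ≤ min δ 1 := by
    intro i
    refine (abs_sum_sub_sum_le fun j => hin i j (x j) ?_).trans ?_
    · rw [abs_of_nonneg (hx.1 j)]
      exact hx.2 j
    · rw [Fintype.card_fin, mul_div_assoc', div_le_iff₀ (by positivity)]
      have : 0 < min δ 1 := by positivity
      nlinarith
  have h1 := happ x hx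
  have h2 : |∑ i, g i (y' i) - ∑ i, g i (y i)| ≤ M * (ε / 4 / M) := by
    simpa using abs_sum_sub_sum_le fun i =>
      hmod i (y i) (hyC i) (y' i) ((hyy i).trans (min_le_left _ _))
  have h3 : |∑ i, ∑ k, d i k * σ (l i k * y' i - γ i k) - ∑ i, g i (y' i)| ≤
      M * (ε / 4 / M) := by
    refine (abs_sum_sub_sum_le fun i => hout i (y' i) ?_).trans (by simp)
    have h4 : |y i| ≤ |L| := (hL _ (hyC i)).trans (le_abs_self L)
    have h5 := (hyy i).trans (min_le_right _ _)
    have h6 := abs_add_le (y' i - y i) (y i)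
    rw [sub_add_cancel] at h6
    linarith
  rw [mul_div_cancel₀ _ hM0.ne'] at h2 h3
  rw [abs_le] at h1 h2 h3
  rw [abs_lt]
  constructor <;> linarith [h1.1, h1.2, h2.1, h2.2, h3.1, h3.2]

/-- Maiorov–Pinkus: a two-hidden-layer network with widths `3n` and `6n+3` and a suitable
analytic strictly increasing activation function approximates any continuous function on
the unit cube to arbitrary accuracy. -/
theorem maiorov_pinkus (n : ℕ) (hn : 1 ≤ n) :
    ∃ σ : ℝ → ℝ, AnalyticOnNhd ℝ σ Set.univ ∧ StrictMono σ ∧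
      ∀ u : EuclideanSpace ℝ (Fin n) → ℝ,
        ContinuousOn u {x | ∀ i, x i ∈ Set.Icc (0 : ℝ) 1} →
        ∀ ε : ℝ, 0 < ε →
          ∃ (d γ : Fin (6 * n + 3) → ℝ) (c θ : Fin (6 * n + 3) → Fin (3 * n) → ℝ)
            (w : Fin (6 * n + 3) → Fin (3 * n) → EuclideanSpace ℝ (Fin n)),
            ∀ x ∈ {x : EuclideanSpace ℝ (Fin n) | ∀ i, x i ∈ Set.Icc (0 : ℝ) 1},
              |u x - ∑ i, d i * σ (∑ j, c i j * σ (⟪w i j, x⟫ - θ i j) - γ i)| < ε := by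
  obtain ⟨σ, hσa, hσm, hσ⟩ := exists_activation
  refine ⟨σ, hσa, hσm, fun u hu ε hε => ?_⟩
  have hu' : Continuous fun x : Fin n → ℝ => u (WithLp.toLp 2 fun j => clampUnit (x j)) := by
    refine hu.comp_continuous ?_ fun x j => clampUnit_mem (x j)
    have := continuous_clampUnit
    fun_prop
  obtain ⟨d, l, γ, d', l', γ', h⟩ := exists_network hσ rfl hu' hε
  let e : Fin (6 * n + 3) ≃ Fin (2 * n + 1) × Fin 3 :=
    (finCongr (by ring)).trans finProdFinEquiv.symm
  let e' : Fin (3 * n) ≃ Fin n × Fin 3 := (finCongr (by ring)).trans finProdFinEquiv.symm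
  refine ⟨fun I => d (e I).1 (e I).2, fun I => γ (e I).1 (e I).2,
    fun I J => l (e I).1 (e I).2 * d' (e I).1 (e' J).1 (e' J).2,
    fun I J => γ' (e I).1 (e' J).1 (e' J).2,
    fun I J => EuclideanSpace.single (e' J).1 (l' (e I).1 (e' J).1 (e' J).2), fun x hx => ?_⟩
  have hx' := h x.ofLp ⟨fun j => (hx j).1, fun j => (hx j).2⟩
  simp only [clampUnit_of_mem (hx _), WithLp.toLp_ofLp] at hx'
  convert hx' using 3
  rw [← Fintype.sum_prod_type', ← e.sum_comp]
  refine Finset.sum_congr rfl fun I _ => ?_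
  rw [← Fintype.sum_prod_type', ← e'.sum_comp, Finset.mul_sum]
  simp [EuclideanSpace.inner_single_left, mul_assoc]
end
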